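/- arXiv:0812.4861 — 2 statements merged into one kernel-verified Lean document; each statement's English description precedes it below -/
import Mathlib

section
/- For every n ≥ 6, every graphic sequence π of n positive integers with σ(π) ≥ 6n − 10 is potentially K6−C5-graphic. -/
/-- The degree of vertex `i` in the simple graph `G`. -/
noncomputable def degCount {n : ℕ} (G : SimpleGraph (Fin n)) (i : Fin n) : ℕ :=
  {j | G.Adj i j}.ncard

/-- The graph `K₆ − C₅`: the complete graph on 6 vertices minus the edges of a
cycle on 5 of its vertices.  Vertex `0` is adjacent to all other vertices, and the
vertices `1,…,5` carry the complement of a 5-cycle (which is again a 5-cycle).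
Its degree sequence is `(5,3,3,3,3,3)`. -/
def K6C5 : SimpleGraph (Fin 6) :=
  SimpleGraph.fromRel (fun a b =>
    a = 0 ∨ b = 0 ∨
      (a, b) ∈ ([(1, 3), (3, 5), (5, 2), (2, 4), (4, 1)] : List (Fin 6 × Fin 6)))

/-- A list of natural numbers is graphic if it is the degree sequence of some
simple graph. -/
def IsGraphic (l : List ℕ) : Prop :=
  ∃ G : SimpleGraph (Fin l.length), ∀ i : Fin l.length, degCount G i = l.get i

/-- A list of natural numbers is potentially `K₆ − C₅`-graphic if it has a
realization containing `K₆ − C₅` as a subgraph. -/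
def PotentiallyK6C5 (l : List ℕ) : Prop :=
  ∃ G : SimpleGraph (Fin l.length),
    (∀ i : Fin l.length, degCount G i = l.get i) ∧
    ∃ f : Fin 6 → Fin l.length, Function.Injective f ∧
      ∀ a b : Fin 6, K6C5.Adj a b → G.Adj (f a) (f b)

open Finset

/-- The number of neighbours of `v` in `G`. -/
noncomputable def dg {V : Type*} (G : SimpleGraph V) (v : V) : ℕ := {w | G.Adj v w}.ncard

/-- `f` embeds `K6C5` into `G`. -/
def IsWheel {V : Type*} (G : SimpleGraph V) (f : Fin 6 → V) : Prop :=
  Function.Injective f ∧ ∀ a b : Fin 6, K6C5.Adj a b → G.Adj (f a) (f b)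

/-- Some graph with the same degrees as `G` contains `K6C5`. -/
def PotWheel {V : Type*} (G : SimpleGraph V) : Prop :=
  ∃ H : SimpleGraph V, (∀ v, dg H v = dg G v) ∧ ∃ f, IsWheel H f

lemma K6C5_adj_iff (a b : Fin 6) : K6C5.Adj a b ↔ a ≠ b ∧ ((a = 0 ∨ b = 0 ∨
      (a, b) ∈ ([(1, 3), (3, 5), (5, 2), (2, 4), (4, 1)] : List (Fin 6 × Fin 6))) ∨
      (b = 0 ∨ a = 0 ∨
      (b, a) ∈ ([(1, 3), (3, 5), (5, 2), (2, 4), (4, 1)] : List (Fin 6 × Fin 6)))) := by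
  simp only [K6C5, SimpleGraph.fromRel_adj]

lemma K6C5_exists_adj (a : Fin 6) : ∃ b, K6C5.Adj a b := by
  simp only [K6C5_adj_iff]
  revert a
  decide

section

variable {V : Type*} {G H : SimpleGraph V}

lemma PotWheel.congr (h : PotWheel H) (hd : ∀ v, dg H v = dg G v) : PotWheel G := by
  obtain ⟨K, hK, hf⟩ := h
  exact ⟨K, fun v => (hK v).trans (hd v), hf⟩

/-- A hub joined to a 5-cycle gives a copy of `K6C5`. -/
lemma exists_isWheel {h r₁ r₂ r₃ r₄ r₅ : V} (h₁ : G.Adj h r₁) (h₂ : G.Adj h r₂)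
    (h₃ : G.Adj h r₃) (h₄ : G.Adj h r₄) (h₅ : G.Adj h r₅) (e₁ : G.Adj r₁ r₂)
    (e₂ : G.Adj r₂ r₃) (e₃ : G.Adj r₃ r₄) (e₄ : G.Adj r₄ r₅) (e₅ : G.Adj r₅ r₁)
    (n₁₃ : r₁ ≠ r₃) (n₁₄ : r₁ ≠ r₄) (n₂₄ : r₂ ≠ r₄) (n₂₅ : r₂ ≠ r₅) (n₃₅ : r₃ ≠ r₅) :
    ∃ f, IsWheel G f := by
  have := h₁.ne; have := h₂.ne; have := h₃.ne; have := h₄.ne; have := h₅.ne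
  have := e₁.ne; have := e₂.ne; have := e₃.ne; have := e₄.ne; have := e₅.ne
  refine ⟨![h, r₁, r₄, r₂, r₅, r₃], ?_, ?_⟩
  · intro a b hab
    fin_cases a <;> fin_cases b <;> simp at hab ⊢ <;> grind
  · intro a b hab
    rw [K6C5_adj_iff] at hab
    fin_cases a <;> fin_cases b <;> simp at hab ⊢ <;> grind [SimpleGraph.adj_comm]

lemma IsWheel.mono {f : Fin 6 → V} (hf : IsWheel G f)
    (h : ∀ v ∈ Set.range f, ∀ w ∈ Set.range f, G.Adj v w → H.Adj v w) : IsWheel H f :=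
  ⟨hf.1, fun a b hab => h _ ⟨a, rfl⟩ _ ⟨b, rfl⟩ (hf.2 a b hab)⟩

lemma IsWheel.exists_adj {f : Fin 6 → V} (hf : IsWheel G f) (a : Fin 6) :
    ∃ w, G.Adj (f a) w :=
  let ⟨b, hb⟩ := K6C5_exists_adj a
  ⟨f b, hf.2 a b hb⟩

/-- The graph `G` with the edge `xy` added. -/
def link (G : SimpleGraph V) (x y : V) : SimpleGraph V := G ⊔ SimpleGraph.edge x y

/-- The graph `G` with the edge `xy` removed. -/
def cut (G : SimpleGraph V) (x y : V) : SimpleGraph V := G \ SimpleGraph.edge x y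

lemma link_adj {x y v w : V} : (link G x y).Adj v w ↔
    G.Adj v w ∨ v ≠ w ∧ (v = x ∧ w = y ∨ v = y ∧ w = x) := by
  simp only [link, SimpleGraph.sup_adj, SimpleGraph.edge_adj]
  tauto

lemma cut_adj {x y v w : V} : (cut G x y).Adj v w ↔
    G.Adj v w ∧ ¬ (v = x ∧ w = y) ∧ ¬ (v = y ∧ w = x) := by
  have := G.ne_of_adj (a := v) (b := w)
  simp only [cut, SimpleGraph.sdiff_adj, SimpleGraph.edge_adj]
  tauto

variable [Fintype V]

lemma dg_eq_degree [DecidableRel G.Adj] (v : V) : dg G v = G.degree v := by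
  rw [dg, Set.ncard_eq_toFinset_card', ← SimpleGraph.card_neighborFinset_eq_degree]
  congr 1

lemma dg_link {x y : V} (hne : x ≠ y) (h : ¬ G.Adj x y) (v : V) [Decidable (v = x ∨ v = y)] :
    dg (link G x y) v = dg G v + if v = x ∨ v = y then 1 else 0 := by
  have h' : ¬ G.Adj y x := fun hh => h hh.symm
  unfold dg
  split_ifs with hv
  · rcases hv with rfl | rfl
    · rw [show {w | (link G v y).Adj v w} = insert y {w | G.Adj v w} by
        ext w; simp only [link_adj, Set.mem_ofPred_eq, Set.mem_insert_iff]; grind]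
      exact Set.ncard_insert_of_notMem h (Set.toFinite _)
    · rw [show {w | (link G x v).Adj v w} = insert x {w | G.Adj v w} by
        ext w; simp only [link_adj, Set.mem_ofPred_eq, Set.mem_insert_iff]; grind]
      exact Set.ncard_insert_of_notMem h' (Set.toFinite _)
  · congr 1
    ext w; simp only [link_adj, Set.mem_ofPred_eq]; grind

omit [Fintype V] in
lemma link_cut {x y : V} (h : G.Adj x y) : link (cut G x y) x y = G := by
  ext v w
  simp only [link_adj, cut_adj]
  grind [SimpleGraph.adj_comm, G.ne_of_adj (a := v) (b := w)]

lemma dg_cut {x y : V} (h : G.Adj x y) (v : V) [Decidable (v = x ∨ v = y)] :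
    dg (cut G x y) v + (if v = x ∨ v = y then 1 else 0) = dg G v := by
  conv_rhs => rw [← link_cut h]
  exact (dg_link h.ne (by simp [cut_adj]) v).symm

/-- The 2-switch replacing the edges `pq`, `xy` by `px`, `qy`. -/
def switch (G : SimpleGraph V) (p q x y : V) : SimpleGraph V :=
  link (link (cut (cut G p q) x y) p x) q y

omit [Fintype V] in
lemma switch_adj {p q x y v w : V} : (switch G p q x y).Adj v w ↔
    ((G.Adj v w ∧ ¬ (v = p ∧ w = q) ∧ ¬ (v = q ∧ w = p)) ∧
      ¬ (v = x ∧ w = y) ∧ ¬ (v = y ∧ w = x) ∨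
      v ≠ w ∧ (v = p ∧ w = x ∨ v = x ∧ w = p)) ∨ v ≠ w ∧ (v = q ∧ w = y ∨ v = y ∧ w = q) := by
  simp only [switch, link_adj, cut_adj]

omit [Fintype V] in
lemma switch_adj_left {p q x y v w : V} (hv : v ≠ p ∧ v ≠ q ∧ v ≠ x ∧ v ≠ y) :
    (switch G p q x y).Adj v w ↔ G.Adj v w := by
  rw [switch_adj]; tauto

omit [Fintype V] in
lemma switch_adj_right {p q x y v w : V} (hw : w ≠ p ∧ w ≠ q ∧ w ≠ x ∧ w ≠ y) :
    (switch G p q x y).Adj v w ↔ G.Adj v w := by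
  rw [switch_adj]; tauto

lemma dg_switch {p q x y : V} (hpq : G.Adj p q) (hxy : G.Adj x y) (hpx : ¬ G.Adj p x)
    (hqy : ¬ G.Adj q y) (npx : p ≠ x) (nqy : q ≠ y) (v : V) :
    dg (switch G p q x y) v = dg G v := by
  classical
  have := hpq.ne
  have := hxy.ne
  have c₁ := dg_cut hpq v
  have c₂ := dg_cut (G := cut G p q) (x := x) (y := y)
    (by simp only [cut_adj]; grind [SimpleGraph.adj_comm]) v
  have c₃ := dg_link (G := cut (cut G p q) x y) npx (by simp only [cut_adj]; tauto) v
  have c₄ := dg_link (G := link (cut (cut G p q) x y) p x) nqy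
    (by simp only [cut_adj, link_adj]; grind [SimpleGraph.adj_comm]) v
  unfold switch
  grind [SimpleGraph.adj_comm]

/-- Replace the edge `xy` by the path `x u y`. -/
def lift (G : SimpleGraph V) (u x y : V) : SimpleGraph V :=
  link (link (cut G x y) u x) u y

/-- Replace the path `a u b` by the edge `ab`. -/
def unlift (G : SimpleGraph V) (u a b : V) : SimpleGraph V :=
  link (cut (cut G u a) u b) a b

lemma dg_lift {u x y : V} (hxy : G.Adj x y) (hux : ¬ G.Adj u x) (huy : ¬ G.Adj u y)
    (nux : u ≠ x) (nuy : u ≠ y) (v : V) [Decidable (v = u)] :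
    dg (lift G u x y) v = dg G v + if v = u then 2 else 0 := by
  classical
  have := hxy.ne
  have c₁ := dg_cut hxy v
  have c₂ := dg_link (G := cut G x y) nux (by simp only [cut_adj]; tauto) v
  have c₃ := dg_link (G := link (cut G x y) u x) nuy
    (by simp only [cut_adj, link_adj]; grind [SimpleGraph.adj_comm]) v
  unfold lift
  grind

lemma dg_unlift {u a b : V} (hua : G.Adj u a) (hub : G.Adj u b) (hab : ¬ G.Adj a b)
    (nab : a ≠ b) (v : V) [Decidable (v = u)] :
    dg (unlift G u a b) v + (if v = u then 2 else 0) = dg G v := by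
  classical
  have c₁ := dg_cut hua v
  have c₂ := dg_cut (G := cut G u a) (x := u) (y := b)
    (by simp only [cut_adj]; grind [SimpleGraph.adj_comm]) v
  have c₃ := dg_link (G := cut (cut G u a) u b) nab (by simp only [cut_adj]; tauto) v
  unfold unlift
  have := hua.ne; have := hub.ne
  grind

omit [Fintype V] in
lemma lift_adj {u x y v w : V} : (lift G u x y).Adj v w ↔
    ((G.Adj v w ∧ ¬ (v = x ∧ w = y) ∧ ¬ (v = y ∧ w = x)) ∨
      v ≠ w ∧ (v = u ∧ w = x ∨ v = x ∧ w = u)) ∨ v ≠ w ∧ (v = u ∧ w = y ∨ v = y ∧ w = u) := by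
  simp only [lift, link_adj, cut_adj]

omit [Fintype V] in
lemma unlift_adj {u a b v w : V} : (unlift G u a b).Adj v w ↔
    ((G.Adj v w ∧ ¬ (v = u ∧ w = a) ∧ ¬ (v = a ∧ w = u)) ∧
      ¬ (v = u ∧ w = b) ∧ ¬ (v = b ∧ w = u)) ∨ v ≠ w ∧ (v = a ∧ w = b ∨ v = b ∧ w = a) := by
  simp only [unlift, link_adj, cut_adj]

/-- The graph `G` with all edges at `u` removed. -/
def isolate (G : SimpleGraph V) (u : V) : SimpleGraph V where
  Adj v w := G.Adj v w ∧ v ≠ u ∧ w ≠ u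
  symm := ⟨fun _ _ h => ⟨h.1.symm, h.2.2, h.2.1⟩⟩
  loopless := ⟨fun _ h => h.1.ne rfl⟩

omit [Fintype V] in
lemma isolate_adj {u v w : V} : (isolate G u).Adj v w ↔ G.Adj v w ∧ v ≠ u ∧ w ≠ u := Iff.rfl

lemma dg_isolate {u v : V} (hv : v ≠ u) [Decidable (G.Adj u v)] :
    dg (isolate G u) v + (if G.Adj u v then 1 else 0) = dg G v := by
  unfold dg
  split_ifs with h
  · rw [← Set.ncard_insert_of_notMem (a := u) _ (Set.toFinite _)]
    · congr 1
      ext w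
      simp only [isolate_adj, Set.mem_ofPred_eq, Set.mem_insert_iff]
      grind [SimpleGraph.adj_comm]
    · simp [isolate_adj]
  · rw [add_zero]
    congr 1
    ext w
    simp only [isolate_adj, Set.mem_ofPred_eq]
    grind [SimpleGraph.adj_comm]

omit [Fintype V] in
lemma dg_isolate_self {u : V} : dg (isolate G u) u = 0 := by
  simp [dg, isolate_adj]

lemma sum_dg_isolate {u : V} : ∑ v, dg (isolate G u) v + 2 * dg G u = ∑ v, dg G v := by
  classical
  have h : ∑ v, (if G.Adj u v then 1 else 0) = dg G u := by
    rw [dg_eq_degree, ← SimpleGraph.card_neighborFinset_eq_degree,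
      SimpleGraph.neighborFinset_eq_filter, Finset.card_filter]
  have e := Finset.sum_congr rfl (s₁ := univ)
    (f := fun v => dg (isolate G u) v + (if G.Adj u v then 1 else 0) + if v = u then dg G u else 0)
    (g := fun v => dg G v) (fun v _ => by
      by_cases hv : v = u
      · subst hv; simp [dg_isolate_self]
      · simpa [hv] using dg_isolate hv)
  simp only [Finset.sum_add_distrib, h, Finset.sum_ite_eq', Finset.mem_univ, if_true] at e
  omega

lemma exists_adj_notMem (v : V) (T : Finset V) (h : T.card < dg G v) :
    ∃ w, G.Adj v w ∧ w ∉ T := by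
  by_contra! hc
  have : dg G v ≤ (T : Set V).ncard := Set.ncard_le_ncard (fun w hw => hc w hw) (Set.toFinite _)
  rw [Set.ncard_coe_finset] at this
  omega

/-- Re-attach the vertex `u` to its neighbours in `G` after re-realizing the degrees of `G - u`. -/
lemma PotWheel.exists_of_isolate {u : V} (h : PotWheel (isolate G u)) :
    ∃ (H : SimpleGraph V) (f : Fin 6 → V), (∀ v, dg H v = dg G v) ∧
      (∀ w, H.Adj u w ↔ G.Adj u w) ∧ IsWheel H f ∧ u ∉ Set.range f := by
  classical
  obtain ⟨K, hK, f, hf⟩ := h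
  have hu : ∀ w, ¬ K.Adj u w := by
    intro w hw
    have h0 : dg K u = 0 := (hK u).trans dg_isolate_self
    rw [dg, Set.ncard_eq_zero (Set.toFinite _)] at h0
    exact h0.subset hw
  have hu' : ∀ w, ¬ K.Adj w u := fun w hw => hu w hw.symm
  let H : SimpleGraph V :=
    { Adj := fun v w => K.Adj v w ∨ v = u ∧ G.Adj u w ∨ w = u ∧ G.Adj u v
      symm := ⟨fun v w h => by
        rcases h with h | h | h
        · exact Or.inl h.symm
        · exact Or.inr (Or.inr h)
        · exact Or.inr (Or.inl h)⟩
      loopless := ⟨fun v h => by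
        rcases h with h | ⟨rfl, h⟩ | ⟨rfl, h⟩ <;> exact h.ne rfl⟩ }
  have hH : ∀ v w, H.Adj v w ↔ K.Adj v w ∨ v = u ∧ G.Adj u w ∨ w = u ∧ G.Adj u v :=
    fun _ _ => Iff.rfl
  have hHu : ∀ w, H.Adj u w ↔ G.Adj u w := by
    intro w; rw [hH]; grind [G.ne_of_adj (a := u) (b := u)]
  have hiso : isolate H u = K := by
    ext v w; rw [isolate_adj, hH]; grind
  refine ⟨H, f, fun v => ?_, hHu, hf.mono fun v _ w _ h => Or.inl h, ?_⟩
  · by_cases hv : v = u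
    · subst hv
      unfold dg
      congr 1
      ext w
      exact hHu w
    · have a := dg_isolate (G := H) hv
      have b := dg_isolate (G := G) hv
      rw [hiso, hK, if_congr (hHu v) rfl rfl] at a
      omega
  · rintro ⟨a, rfl⟩
    obtain ⟨w, hw⟩ := hf.exists_adj a
    exact hu _ hw

end

/-- Every graph on `m` vertices of `V` with degree sum at least `6 * m - 10` is potentially
`K6C5`-graphic. -/
def SumBound (V : Type*) [Fintype V] (m : ℕ) : Prop :=
  ∀ (G : SimpleGraph V) (S : Finset V), S.card = m → (∀ v w, G.Adj v w → v ∈ S) →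
    6 * m ≤ ∑ v, dg G v + 10 → PotWheel G

section

variable {V : Type*} [Fintype V] {G : SimpleGraph V} {S : Finset V} {u : V}

lemma SumBound.exists_wheel_notMem (hIH : SumBound V (S.card - 1)) (hu : u ∈ S)
    (hS : ∀ v w, G.Adj v w → v ∈ S) (hsum : 6 * S.card + 2 * dg G u ≤ ∑ v, dg G v + 16) :
    ∃ (H : SimpleGraph V) (f : Fin 6 → V), (∀ v, dg H v = dg G v) ∧
      (∀ w, H.Adj u w ↔ G.Adj u w) ∧ IsWheel H f ∧ u ∉ Set.range f := by
  classical
  refine PotWheel.exists_of_isolate (hIH (isolate G u) (S.erase u) (card_erase_of_mem hu) ?_ ?_)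
  · intro v w hvw
    exact mem_erase.2 ⟨hvw.2.1, hS v w hvw.1⟩
  · have := sum_dg_isolate (G := G) (u := u)
    omega

lemma sum_dg_unlift {a b : V} (hua : G.Adj u a) (hub : G.Adj u b) (hab : ¬ G.Adj a b)
    (nab : a ≠ b) : ∑ v, dg (unlift G u a b) v + 2 = ∑ v, dg G v := by
  classical
  have e := Finset.sum_congr rfl (s₁ := univ) fun v _ => dg_unlift hua hub hab nab v
  simpa [Finset.sum_add_distrib] using e

omit [Fintype V] in
lemma exists_mem_notMem_range (f : Fin 6 → V) (T : Finset V) (h : 6 + T.card < S.card) :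
    ∃ z ∈ S, z ∉ Set.range f ∧ z ∉ T := by
  classical
  obtain ⟨z, hz, hz'⟩ := exists_mem_notMem_of_card_lt_card (s := image f univ ∪ T) (t := S) (by
    have h₁ := card_union_le (image f univ) T
    have h₂ := card_image_le (s := univ) (f := f)
    simp only [card_univ, Fintype.card_fin] at h₂
    omega)
  refine ⟨z, hz, ?_, fun h => hz' (mem_union_right _ h)⟩
  rintro ⟨i, rfl⟩
  exact hz' (mem_union_left _ (mem_image_of_mem _ (mem_univ i)))

omit [Fintype V] in
lemma IsWheel.lift {f : Fin 6 → V} (hf : IsWheel G f) {z y : V} (hz : z ∉ Set.range f) :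
    IsWheel (lift G u z y) f :=
  hf.mono fun v hv w hw h => by
    rw [lift_adj]
    exact Or.inl (Or.inl ⟨h, fun e => hz (e.1 ▸ hv), fun e => hz (e.2 ▸ hw)⟩)

lemma potWheel_of_degree_four (hS : ∀ v w, G.Adj v w → v ∈ S) (hcard : 10 ≤ S.card)
    (hIH : SumBound V (S.card - 1)) (hmin : ∀ v ∈ S, 4 ≤ dg G v)
    (hsum : 6 * S.card ≤ ∑ v, dg G v + 10) (hu : dg G u = 4) {a b c d : V}
    (hN : ∀ w, G.Adj u w ↔ w = a ∨ w = b ∨ w = c ∨ w = d) (nab : a ≠ b) (nac : a ≠ c)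
    (nad : a ≠ d) (nbc : b ≠ c) (nbd : b ≠ d) (hab : ¬ G.Adj a b) : PotWheel G := by
  classical
  have hua : G.Adj u a := by simp [hN]
  have hub : G.Adj u b := by simp [hN]
  have huc : G.Adj u c := by simp [hN]
  have hud : G.Adj u d := by simp [hN]
  have n₁ := hua.ne
  have n₂ := hub.ne
  have n₃ := huc.ne
  have n₄ := hud.ne
  have hd := dg_unlift hua hub hab nab
  have hs := sum_dg_unlift hua hub hab nab
  have hdu := hd u
  rw [if_pos rfl, hu] at hdu
  obtain ⟨H, f, hH, hHu, hf, huf⟩ := SumBound.exists_wheel_notMem (G := unlift G u a b)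
    hIH (hS u a hua) (by
      intro v w
      rw [unlift_adj]
      have := hS a u hua.symm
      have := hS b u hub.symm
      grind) (by omega)
  have hHN : ∀ w, H.Adj u w ↔ w = c ∨ w = d := by
    intro w
    rw [hHu, unlift_adj, hN]
    grind
  obtain ⟨z, hzS, hzf, hzT⟩ := exists_mem_notMem_range (S := S) f {u, c, d} (by
    have := card_le_three (a := u) (b := c) (c := d)
    omega)
  simp only [mem_insert, mem_singleton, not_or] at hzT
  obtain ⟨y, hzy, hyT⟩ := exists_adj_notMem (G := H) z {u, c, d} (by
    have := card_le_three (a := u) (b := c) (c := d)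
    have h₁ := hd z
    rw [if_neg hzT.1] at h₁
    have h₂ := hmin z hzS
    rw [hH]
    omega)
  simp only [mem_insert, mem_singleton, not_or] at hyT
  refine ⟨lift H u z y, fun v => ?_, f, hf.lift hzf⟩
  rw [dg_lift hzy (by rw [hHN]; tauto) (by rw [hHN]; tauto) (Ne.symm hzT.1) (Ne.symm hyT.1),
    hH, hd]

lemma potWheel_of_degree_five (hS : ∀ v w, G.Adj v w → v ∈ S) (hcard : 10 ≤ S.card)
    (hIH : SumBound V (S.card - 1)) (hmin : ∀ v ∈ S, 5 ≤ dg G v)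
    (hsum : 6 * S.card ≤ ∑ v, dg G v + 10) (hu : dg G u = 5) {a b c d e : V}
    (hN : ∀ w, G.Adj u w ↔ w = a ∨ w = b ∨ w = c ∨ w = d ∨ w = e)
    (hne : [a, b, c, d, e].Nodup) (hab : ¬ G.Adj a b) (hcd : ¬ G.Adj c d) : PotWheel G := by
  classical
  simp only [List.nodup_cons, List.mem_cons, List.not_mem_nil, not_or, or_false,
    not_false_eq_true, List.nodup_nil, and_true] at hne
  obtain ⟨⟨nab, nac, nad, nae⟩, ⟨nbc, nbd, nbe⟩, ⟨ncd, nce⟩, nde⟩ := hne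
  have hua : G.Adj u a := by simp [hN]
  have hub : G.Adj u b := by simp [hN]
  have huc : G.Adj u c := by simp [hN]
  have hud : G.Adj u d := by simp [hN]
  have hue : G.Adj u e := by simp [hN]
  have n₁ := hua.ne
  have n₂ := hub.ne
  have n₃ := huc.ne
  have n₄ := hud.ne
  have n₅ := hue.ne
  have hd := dg_unlift hua hub hab nab
  have hs := sum_dg_unlift hua hub hab nab
  set G₁ := unlift G u a b with hG₁
  have huc' : G₁.Adj u c := by rw [hG₁, unlift_adj]; grind
  have hud' : G₁.Adj u d := by rw [hG₁, unlift_adj]; grind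
  have hcd' : ¬ G₁.Adj c d := by rw [hG₁, unlift_adj]; grind
  have hd' := dg_unlift huc' hud' hcd' ncd
  have hs' := sum_dg_unlift huc' hud' hcd' ncd
  have hdu := hd u
  have hdu' := hd' u
  rw [if_pos rfl] at hdu hdu'
  obtain ⟨H, f, hH, hHu, hf, huf⟩ := SumBound.exists_wheel_notMem (G := unlift G₁ u c d)
    hIH (hS u a hua) (by
      intro v w
      rw [unlift_adj, hG₁, unlift_adj]
      have := hS a u hua.symm
      have := hS b u hub.symm
      have := hS c u huc.symm
      have := hS d u hud.symm
      grind) (by omega)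
  have hHN : ∀ w, H.Adj u w ↔ w = e := by
    intro w
    rw [hHu, unlift_adj, hG₁, unlift_adj, hN]
    grind
  obtain ⟨z, hzS, hzf, hzT⟩ := exists_mem_notMem_range (S := S) f {u, e} (by
    have := card_le_two (a := u) (b := e)
    omega)
  obtain ⟨z', hzS', hzf', hzT'⟩ := exists_mem_notMem_range (S := S) f {u, e, z} (by
    have := card_le_three (a := u) (b := e) (c := z)
    omega)
  simp only [mem_insert, mem_singleton, not_or] at hzT hzT'
  have hdeg : ∀ v ∈ S, v ≠ u → 5 ≤ dg H v := by
    intro v hv hvu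
    have h₁ := hd v
    have h₂ := hd' v
    rw [if_neg hvu] at h₁ h₂
    have h₃ := hmin v hv
    rw [hH]
    omega
  obtain ⟨p, hzp, hpT⟩ := exists_adj_notMem (G := H) z {u, e, z'} (by
    have := card_le_three (a := u) (b := e) (c := z')
    have := hdeg z hzS hzT.1
    omega)
  obtain ⟨q, hzq, hqT⟩ := exists_adj_notMem (G := H) z' {u, e, z, p} (by
    have := card_le_four (a := u) (b := e) (c := z) (d := p)
    have := hdeg z' hzS' hzT'.1
    omega)
  simp only [mem_insert, mem_singleton, not_or] at hpT hqT
  refine ⟨lift (lift H u z p) u z' q, fun v => ?_, f, (hf.lift hzf).lift hzf'⟩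
  rw [dg_lift, dg_lift, hH, ← hd, ← hd']
  all_goals try simp only [lift_adj, hHN]
  all_goals grind

end

section

variable {V : Type*} {G : SimpleGraph V} {S T : Finset V} {u : V}

lemma exists_isWheel_of_isClique {K : Finset V} (hK : G.IsClique (K : Set V)) (hc : K.card = 5)
    {x : V} (hx : x ∉ K) [DecidablePred (G.Adj x)] (h : 2 < (K.filter (G.Adj x)).card) :
    ∃ f, IsWheel G f := by
  classical
  obtain ⟨p, hp, q, hq, r, hr, hpq, hpr, hqr⟩ := two_lt_card.1 h
  rw [mem_filter] at hp hq hr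
  have h2 : (K \ {p, q, r}).card = 2 := by
    rw [card_sdiff_of_subset (by simp [insert_subset_iff, *]), hc,
      card_eq_three.2 ⟨p, q, r, hpq, hpr, hqr, rfl⟩]
  obtain ⟨s, t, hst, hst'⟩ := card_eq_two.1 h2
  have hs : s ∈ K \ {p, q, r} := by simp [hst']
  have ht : t ∈ K \ {p, q, r} := by simp [hst']
  simp only [mem_sdiff, mem_insert, mem_singleton, not_or] at hs ht
  have hadj : ∀ {v w}, v ∈ K → w ∈ K → v ≠ w → G.Adj v w := fun hv hw => hK hv hw
  refine exists_isWheel (h := p) (r₁ := x) (r₂ := q) (r₃ := s) (r₄ := t) (r₅ := r)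
    hp.2.symm (hadj hp.1 hq.1 hpq) (hadj hp.1 hs.1 ?_) (hadj hp.1 ht.1 ?_) (hadj hp.1 hr.1 hpr)
    hq.2 (hadj hq.1 hs.1 ?_) (hadj hs.1 ht.1 hst) (hadj ht.1 hr.1 ?_) hr.2.symm ?_ ?_ ?_ hqr ?_
  all_goals grind

/-- A vertex with three neighbours in a 5-clique `insert u T` gives a copy of `K6C5`. -/
lemma card_filter_adj_le_two (hno : ¬ ∃ f, IsWheel G f) (hT : G.IsClique (T : Set V))
    (hc : T.card = 4) (hu : ∀ w ∈ T, G.Adj u w) {x : V} (hxT : x ∉ T) (hxu : x ≠ u)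
    [DecidablePred (G.Adj x)] [DecidableEq V] :
    ((insert u T).filter (G.Adj x)).card ≤ 2 := by
  by_contra! h
  refine hno (exists_isWheel_of_isClique (K := insert u T) ?_ ?_ ?_ h)
  · rw [coe_insert, SimpleGraph.isClique_insert]
    exact ⟨hT, fun b hb _ => hu b hb⟩
  · rw [card_insert_of_notMem (fun h => (hu u h).ne rfl), hc]
  · simp [hxT, hxu]

lemma card_filter_adj_add_card_sdiff (x : V) [DecidablePred (G.Adj x)] [DecidableEq V] :
    (T.filter (G.Adj x)).card + (T.filter fun w => ¬ G.Adj x w).card = T.card :=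
  card_filter_add_card_filter_not _

variable [Fintype V]

lemma potWheel_of_isClique_four (hS : ∀ v w, G.Adj v w → v ∈ S) (hcard : 10 ≤ S.card)
    (hIH : SumBound V (S.card - 1)) (hmin : ∀ v ∈ S, 4 ≤ dg G v)
    (hsum : 6 * S.card ≤ ∑ v, dg G v + 10) (hu : dg G u = 4)
    (hN : ∀ w, G.Adj u w ↔ w ∈ T) (hc : T.card = 4) (hT : G.IsClique (T : Set V)) :
    PotWheel G := by
  classical
  by_contra hno
  have hno' : ¬ ∃ f, IsWheel G f := fun h => hno ⟨G, fun _ => rfl, h⟩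
  have huT : u ∉ T := fun h => ((hN u).2 h).ne rfl
  have hle : ∀ x, x ∉ insert u T → ((insert u T).filter (G.Adj x)).card ≤ 2 := fun x hx =>
    card_filter_adj_le_two hno' hT hc (fun w hw => (hN w).2 hw)
      (fun h => hx (mem_insert_of_mem h)) (fun h => hx (h ▸ mem_insert_self _ _))
  have hge : ∀ x, x ∉ insert u T → 2 ≤ (T.filter fun w => ¬ G.Adj x w).card := by
    intro x hx
    have h₁ := hle x hx
    have h₂ := card_le_card (filter_subset_filter (G.Adj x) (subset_insert u T))
    have h₃ := card_filter_adj_add_card_sdiff (G := G) (T := T) x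
    omega
  obtain ⟨x, hxS, hx⟩ := exists_mem_notMem_of_card_lt_card (s := insert u T) (t := S) (by
    rw [card_insert_of_notMem huT]; omega)
  obtain ⟨y, hxy, hy⟩ := exists_adj_notMem (G := G) x _ ((hle x hx).trans_lt (by
    have := hmin x hxS
    omega))
  have hy' : y ∉ insert u T := fun h => hy (mem_filter.2 ⟨h, hxy⟩)
  obtain ⟨q, hq⟩ := card_pos.1 (lt_of_lt_of_le (by norm_num) (hge y hy'))
  obtain ⟨b, hb, hbq⟩ := exists_mem_ne (lt_of_lt_of_le (by norm_num) (hge x hx)) q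
  rw [mem_filter] at hq hb
  have h2 : (T \ {q, b}).card = 2 := by
    rw [card_sdiff_of_subset (by simp [insert_subset_iff, *]), hc, card_pair hbq.symm]
  obtain ⟨c, d, hcd, hcd'⟩ := card_eq_two.1 h2
  have hTm : ∀ w, w ∈ T ↔ w = q ∨ w = b ∨ w = c ∨ w = d := by
    intro w
    have := Finset.ext_iff.1 hcd' w
    simp only [mem_sdiff, mem_insert, mem_singleton] at this
    grind
  have hc' := Finset.ext_iff.1 hcd' c
  have hd' := Finset.ext_iff.1 hcd' d
  simp only [mem_sdiff, mem_insert, mem_singleton, true_or, or_true, iff_true, not_or] at hc' hd' hx hy'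
  have hdg := dg_switch (p := u) (q := q) (x := x) (y := y) ((hN q).2 hq.1) hxy
    (by rw [hN]; tauto) (fun h => hq.2 h.symm) (by tauto) (by grind)
  refine hno (PotWheel.congr (potWheel_of_degree_four (S := S) (u := u) (a := x) (b := b) (c := c)
    (d := d) ?_ hcard hIH (fun v hv => (hdg v).symm ▸ hmin v hv) (by simpa only [hdg] using hsum)
    (by rw [hdg, hu]) ?_ ?_ ?_ ?_ ?_ ?_ ?_) hdg)
  · intro v w
    rw [switch_adj]
    have := hS u q ((hN q).2 hq.1)
    have := hS q u ((hN q).2 hq.1).symm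
    have := hS y x hxy.symm
    grind
  · intro w
    rw [switch_adj, hN, hTm]
    grind
  · grind
  · grind
  · grind
  · grind
  · grind
  · rw [switch_adj]
    grind

lemma potWheel_of_isClique_five (hS : ∀ v w, G.Adj v w → v ∈ S) (hcard : 10 ≤ S.card)
    (hIH : SumBound V (S.card - 1)) (hmin : ∀ v ∈ S, 5 ≤ dg G v)
    (hsum : 6 * S.card ≤ ∑ v, dg G v + 10) (hu : dg G u = 5) {a : V}
    (hN : ∀ w, G.Adj u w ↔ w = a ∨ w ∈ T) (ha : a ∉ T) (hc : T.card = 4)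
    (hT : G.IsClique (T : Set V)) : PotWheel G := by
  classical
  by_contra hno
  have hno' : ¬ ∃ f, IsWheel G f := fun h => hno ⟨G, fun _ => rfl, h⟩
  have huT : u ∉ T := fun h => ((hN u).2 (Or.inr h)).ne rfl
  have hua : G.Adj u a := (hN a).2 (Or.inl rfl)
  have hle : ∀ x, x ∉ insert u T → ((insert u T).filter (G.Adj x)).card ≤ 2 := fun x hx =>
    card_filter_adj_le_two hno' hT hc (fun w hw => (hN w).2 (Or.inr hw))
      (fun h => hx (mem_insert_of_mem h)) (fun h => hx (h ▸ mem_insert_self _ _))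
  have hge : ∀ x, x ∉ insert u T → 2 ≤ (T.filter fun w => ¬ G.Adj x w).card := by
    intro x hx
    have h₁ := hle x hx
    have h₂ := card_le_card (filter_subset_filter (G.Adj x) (subset_insert u T))
    have h₃ := card_filter_adj_add_card_sdiff (G := G) (T := T) x
    omega
  have hgea : 3 ≤ (T.filter fun w => ¬ G.Adj a w).card := by
    have h₁ := hle a (by simp [ha, hua.ne.symm])
    rw [filter_insert, if_pos hua.symm, card_insert_of_notMem (by simp [huT])] at h₁
    have h₃ := card_filter_adj_add_card_sdiff (G := G) (T := T) a
    omega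
  obtain ⟨x, hxS, hx⟩ := exists_mem_notMem_of_card_lt_card (s := insert a (insert u T)) (t := S) (by
    have := card_insert_le a (insert u T)
    have := card_insert_le u T
    omega)
  rw [mem_insert, not_or] at hx
  obtain ⟨y, hxy, hy⟩ := exists_adj_notMem (G := G) x (insert a ((insert u T).filter (G.Adj x))) (by
    have := hmin x hxS
    have := hle x hx.2
    have := card_insert_le a ((insert u T).filter (G.Adj x))
    omega)
  rw [mem_insert, not_or] at hy
  have hy' : y ∉ insert u T := fun h => hy.2 (mem_filter.2 ⟨h, hxy⟩)
  obtain ⟨q, hq⟩ := card_pos.1 (lt_of_lt_of_le (by norm_num) (hge y hy'))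
  obtain ⟨b, hb, hbq⟩ := exists_mem_ne (lt_of_lt_of_le (by norm_num) (hge x hx.2)) q
  obtain ⟨p, hp, hpT⟩ := exists_mem_notMem_of_card_lt_card (s := {q, b})
    (t := T.filter fun w => ¬ G.Adj a w) (by
      have := card_le_two (a := q) (b := b)
      omega)
  simp only [mem_filter, mem_insert, mem_singleton, not_or] at hq hb hp hpT
  have h1 : (T \ {q, b, p}).card = 1 := by
    rw [card_sdiff_of_subset (by simp [insert_subset_iff, *]), hc,
      card_eq_three.2 ⟨q, b, p, hbq.symm, Ne.symm hpT.1, Ne.symm hpT.2, rfl⟩]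
  obtain ⟨e, he⟩ := card_eq_one.1 h1
  have hTm : ∀ w, w ∈ T ↔ w = q ∨ w = b ∨ w = p ∨ w = e := by
    intro w
    have := Finset.ext_iff.1 he w
    simp only [mem_sdiff, mem_insert, mem_singleton] at this
    grind
  have he' := Finset.ext_iff.1 he e
  simp only [mem_sdiff, mem_insert, mem_singleton, iff_true, not_or] at he' hx hy'
  have huq : G.Adj u q := (hN q).2 (Or.inr hq.1)
  have hdg := dg_switch (p := u) (q := q) (x := x) (y := y) huq hxy
    (by rw [hN]; tauto) (fun h => hq.2 h.symm) (by tauto) (by grind)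
  refine hno (PotWheel.congr (potWheel_of_degree_five (S := S) (u := u) (a := x) (b := b) (c := a)
    (d := p) (e := e) ?_ hcard hIH (fun v hv => (hdg v).symm ▸ hmin v hv)
    (by simpa only [hdg] using hsum) (by rw [hdg, hu]) ?_ ?_ ?_ ?_) hdg)
  · intro v w
    rw [switch_adj]
    have := hS u q huq
    have := hS q u huq.symm
    have := hS y x hxy.symm
    grind
  · intro w
    rw [switch_adj, hN, hTm]
    have := hua.ne
    grind
  · simp only [List.nodup_cons, List.mem_cons, List.not_mem_nil, not_or, or_false,
      not_false_eq_true, List.nodup_nil, and_true]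
    grind
  · rw [switch_adj]
    grind
  · rw [switch_adj]
    have := hua.ne
    grind

end

/-- The neighbourhood of `u` is the join of an edge `df` and three independent vertices. -/
structure TriangleJoin {V : Type*} (G : SimpleGraph V) (u a b c d f : V) : Prop where
  adj_iff : ∀ w, G.Adj u w ↔ w = a ∨ w = b ∨ w = c ∨ w = d ∨ w = f
  nodup : [a, b, c, d, f].Nodup
  not_ab : ¬ G.Adj a b
  not_ac : ¬ G.Adj a c
  not_bc : ¬ G.Adj b c
  df : G.Adj d f
  da : G.Adj d a
  db : G.Adj d b
  dc : G.Adj d c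
  fa : G.Adj f a
  fb : G.Adj f b
  fc : G.Adj f c

/-- `G` lives on at least ten vertices `S`, has minimum degree five on `S`, attained at `u`, and
degree sum at least `6 * S.card - 10`. -/
structure MinDegreeFive {V : Type*} [Fintype V] (G : SimpleGraph V) (S : Finset V) (u : V) :
    Prop where
  mem_of_adj : ∀ v w, G.Adj v w → v ∈ S
  card : 10 ≤ S.card
  min : ∀ v ∈ S, 5 ≤ dg G v
  sum : 6 * S.card ≤ ∑ v, dg G v + 10
  dg_eq : dg G u = 5

section

variable {V : Type*} {G : SimpleGraph V} {S : Finset V} {u a b c d f : V}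

lemma TriangleJoin.ua (h : TriangleJoin G u a b c d f) : G.Adj u a :=
  (h.adj_iff a).2 (Or.inl rfl)

lemma TriangleJoin.ub (h : TriangleJoin G u a b c d f) : G.Adj u b :=
  (h.adj_iff b).2 (Or.inr (Or.inl rfl))

lemma TriangleJoin.uc (h : TriangleJoin G u a b c d f) : G.Adj u c :=
  (h.adj_iff c).2 (Or.inr (Or.inr (Or.inl rfl)))

lemma TriangleJoin.ud (h : TriangleJoin G u a b c d f) : G.Adj u d :=
  (h.adj_iff d).2 (Or.inr (Or.inr (Or.inr (Or.inl rfl))))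

lemma TriangleJoin.uf (h : TriangleJoin G u a b c d f) : G.Adj u f :=
  (h.adj_iff f).2 (Or.inr (Or.inr (Or.inr (Or.inr rfl))))

lemma TriangleJoin.rotate (h : TriangleJoin G u a b c d f) : TriangleJoin G u b c a d f where
  adj_iff w := by rw [h.adj_iff]; tauto
  nodup := by have := h.nodup; simp at this ⊢; grind
  not_ab := h.not_bc
  not_ac := fun e => h.not_ab e.symm
  not_bc := fun e => h.not_ac e.symm
  df := h.df
  da := h.db
  db := h.dc
  dc := h.da
  fa := h.fb
  fb := h.fc
  fc := h.fa

lemma TriangleJoin.swap (h : TriangleJoin G u a b c d f) : TriangleJoin G u a b c f d where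
  adj_iff w := by rw [h.adj_iff]; tauto
  nodup := by have := h.nodup; simp at this ⊢; grind
  not_ab := h.not_ab
  not_ac := h.not_ac
  not_bc := h.not_bc
  df := h.df.symm
  da := h.fa
  db := h.fb
  dc := h.fc
  fa := h.da
  fb := h.db
  fc := h.dc

lemma TriangleJoin.ne (h : TriangleJoin G u a b c d f) :
    (u ≠ a ∧ u ≠ b ∧ u ≠ c ∧ u ≠ d ∧ u ≠ f) ∧ (a ≠ b ∧ a ≠ c ∧ a ≠ d ∧ a ≠ f) ∧
      (b ≠ c ∧ b ≠ d ∧ b ≠ f) ∧ (c ≠ d ∧ c ≠ f) ∧ d ≠ f := by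
  have h₁ := h.nodup
  have h₂ := h.adj_iff u
  simp at h₁ h₂
  tauto

/-- A further common neighbour of the three independent vertices and `d` gives a copy of
`K6C5`. -/
lemma TriangleJoin.exists_isWheel (h : TriangleJoin G u a b c d f) {x : V} (hux : u ≠ x)
    (hx : ¬ G.Adj u x) (xa : G.Adj x a) (xb : G.Adj x b) (xd : G.Adj x d) :
    ∃ g, IsWheel G g := by
  have hN := h.adj_iff
  have hne := h.ne
  have hNx := hN x
  refine _root_.exists_isWheel (h := d) (r₁ := u) (r₂ := f) (r₃ := a) (r₄ := x) (r₅ := b)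
    h.ud.symm h.df h.da xd.symm h.db h.uf h.fa xa.symm xb
    h.ub.symm ?_ ?_ ?_ ?_ ?_ <;> grind

/-- An edge `xy` outside the closed neighbourhood of `u`, with `x`, `y` both adjacent to `d` and
`f` and with `x` adjacent to `a`, gives a copy of `K6C5`. -/
lemma TriangleJoin.exists_isWheel_of_edge (h : TriangleJoin G u a b c d f) {x y : V} (hux : u ≠ x)
    (hx : ¬ G.Adj u x) (huy : u ≠ y) (hy : ¬ G.Adj u y) (hxy : G.Adj x y) (xa : G.Adj x a)
    (xd : G.Adj x d) (yd : G.Adj y d) (yf : G.Adj y f) : ∃ g, IsWheel G g := by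
  have hN := h.adj_iff
  have hne := h.ne
  have hNx := hN x
  have hNy := hN y
  refine _root_.exists_isWheel (h := d) (r₁ := y) (r₂ := x) (r₃ := a) (r₄ := u) (r₅ := f)
    yd.symm xd.symm h.da h.ud.symm h.df hxy.symm xa h.ua.symm
    h.uf yf.symm ?_ ?_ ?_ ?_ ?_ <;> grind

variable [Fintype V]

lemma MinDegreeFive.congr (h : MinDegreeFive G S u) {H : SimpleGraph V}
    (hS : ∀ v w, H.Adj v w → v ∈ S) (hd : ∀ v, dg H v = dg G v) : MinDegreeFive H S u where
  mem_of_adj := hS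
  card := h.card
  min v hv := (hd v).symm ▸ h.min v hv
  sum := by simpa only [hd] using h.sum
  dg_eq := (hd u).trans h.dg_eq

lemma MinDegreeFive.switch (h : MinDegreeFive G S u) {p q x y : V} (hpq : G.Adj p q)
    (hxy : G.Adj x y) (hpx : ¬ G.Adj p x) (hqy : ¬ G.Adj q y) (npx : p ≠ x) (nqy : q ≠ y) :
    MinDegreeFive (switch G p q x y) S u := by
  refine h.congr (fun v w => ?_) (dg_switch hpq hxy hpx hqy npx nqy)
  rw [switch_adj]
  have := h.mem_of_adj v w
  have := h.mem_of_adj p q hpq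
  have := h.mem_of_adj q p hpq.symm
  have := h.mem_of_adj x y hxy
  have := h.mem_of_adj y x hxy.symm
  grind

lemma MinDegreeFive.potWheel_of_edge_aux (h : MinDegreeFive G S u)
    (hIH : SumBound V (S.card - 1)) (ht : TriangleJoin G u a b c d f) {x y : V} (hux : u ≠ x)
    (hx : ¬ G.Adj u x) (huy : u ≠ y) (hy : ¬ G.Adj u y) (hxy : G.Adj x y) (dy : ¬ G.Adj y d)
    (xa : ¬ G.Adj x a) : PotWheel G := by
  have hN := ht.adj_iff
  have hne := ht.ne
  have hNx := hN x
  have hNy := hN y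
  have hud := ht.ud
  have nbc := ht.not_bc
  have dy' : ¬ G.Adj d y := fun e => dy e.symm
  have h' := h.switch hud hxy hx dy' hux (by grind)
  refine (potWheel_of_degree_five (a := x) (b := a) (c := b) (d := c) (e := f) h'.mem_of_adj h'.card
    hIH h'.min h'.sum h'.dg_eq ?_ ?_ ?_ ?_).congr (dg_switch hud hxy hx dy' hux (by grind))
  · intro w
    rw [switch_adj, hN]
    grind
  · simp only [List.nodup_cons, List.mem_cons, List.not_mem_nil, not_or, or_false,
      not_false_eq_true, List.nodup_nil, and_true]
    grind
  · rw [switch_adj]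
    grind
  · rw [switch_adj]
    grind

lemma MinDegreeFive.potWheel_of_edge (h : MinDegreeFive G S u)
    (hIH : SumBound V (S.card - 1)) (ht : TriangleJoin G u a b c d f) {x y : V} (hux : u ≠ x)
    (hx : ¬ G.Adj u x) (huy : u ≠ y) (hy : ¬ G.Adj u y) (hxy : G.Adj x y) (dy : ¬ G.Adj y d)
    (hx' : ¬ (G.Adj x a ∧ G.Adj x b ∧ G.Adj x c)) : PotWheel G := by
  by_cases xa : G.Adj x a
  · by_cases xb : G.Adj x b
    · exact h.potWheel_of_edge_aux hIH ht.rotate.rotate hux hx huy hy hxy dy (by tauto)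
    · exact h.potWheel_of_edge_aux hIH ht.rotate hux hx huy hy hxy dy xb
  · exact h.potWheel_of_edge_aux hIH ht hux hx huy hy hxy dy xa

/-- Two nonadjacent vertices `x`, `z` outside the closed neighbourhood of `u`, adjacent to `a` and
`b` respectively, allow a switch creating the edge `ab`. -/
lemma TriangleJoin.potWheel_of_not_adj (ht : TriangleJoin G u a b c d f) {x z : V} (hux : u ≠ x)
    (hx : ¬ G.Adj u x) (huz : u ≠ z) (hz : ¬ G.Adj u z) (xa : G.Adj x a) (zb : G.Adj z b)
    (hxz : x ≠ z) (h : ¬ G.Adj x z) : PotWheel G := by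
  have hN := ht.adj_iff
  have hne := ht.ne
  have hNx := hN x
  have hNz := hN z
  have hu : u ≠ a ∧ u ≠ x ∧ u ≠ b ∧ u ≠ z := ⟨hne.1.1, hux, hne.1.2.1, huz⟩
  have hc : c ≠ a ∧ c ≠ x ∧ c ≠ b ∧ c ≠ z := by grind
  have hd : d ≠ a ∧ d ≠ x ∧ d ≠ b ∧ d ≠ z := by grind
  have hf : f ≠ a ∧ f ≠ x ∧ f ≠ b ∧ f ≠ z := by grind
  refine ⟨_, dg_switch xa.symm zb.symm ht.not_ab h hne.2.1.1 hxz, ?_⟩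
  exact _root_.exists_isWheel (h := d) (r₁ := a) (r₂ := b) (r₃ := u) (r₄ := c) (r₅ := f)
    ((switch_adj_left hd).2 ht.da) ((switch_adj_left hd).2 ht.db)
    ((switch_adj_left hd).2 ht.ud.symm) ((switch_adj_left hd).2 ht.dc)
    ((switch_adj_left hd).2 ht.df)
    (switch_adj.2 (Or.inl (Or.inr ⟨hne.2.1.1, Or.inl ⟨rfl, rfl⟩⟩)))
    ((switch_adj_right hu).2 ht.ub.symm) ((switch_adj_left hu).2 ht.uc)
    ((switch_adj_left hc).2 ht.fc.symm) ((switch_adj_left hf).2 ht.fa) hu.1.symm hc.1.symm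
    hc.2.2.1.symm hf.2.2.1.symm hne.1.2.2.2.2

/-- An edge `ww'` outside the closed neighbourhood of `u` can be switched with an edge `xy` so that
`MinDegreeFive.potWheel_of_edge` applies to `wx`. -/
lemma MinDegreeFive.potWheel_of_two_edges (h : MinDegreeFive G S u)
    (hIH : SumBound V (S.card - 1)) (ht : TriangleJoin G u a b c d f) {x y w w' : V}
    (hx : u ≠ x ∧ ¬ G.Adj u x) (hy : u ≠ y ∧ ¬ G.Adj u y) (hw : u ≠ w ∧ ¬ G.Adj u w)
    (hw' : u ≠ w' ∧ ¬ G.Adj u w') (hxy : G.Adj x y) (hww' : G.Adj w w') (hxw : ¬ G.Adj x w)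
    (hyw : ¬ G.Adj y w') (nxw : x ≠ w) (nyw : y ≠ w') (xd : ¬ G.Adj x d)
    (hwf : ¬ (G.Adj w a ∧ G.Adj w b ∧ G.Adj w c)) : PotWheel G := by
  have hN := ht.adj_iff
  have hne := ht.ne
  have hsw : ∀ v, v = u ∨ G.Adj u v → v ≠ x ∧ v ≠ y ∧ v ≠ w ∧ v ≠ w' := by
    rintro v (rfl | hv)
    · exact ⟨hx.1, hy.1, hw.1, hw'.1⟩
    · refine ⟨?_, ?_, ?_, ?_⟩ <;> rintro rfl
      exacts [hx.2 hv, hy.2 hv, hw.2 hv, hw'.2 hv]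
  have hu := hsw u (Or.inl rfl)
  have ha := hsw a (Or.inr ht.ua)
  have hb := hsw b (Or.inr ht.ub)
  have hc := hsw c (Or.inr ht.uc)
  have hd := hsw d (Or.inr ht.ud)
  have hf := hsw f (Or.inr ht.uf)
  have ht' : TriangleJoin (_root_.switch G x y w w') u a b c d f :=
    { adj_iff := fun v => by rw [switch_adj_left hu, hN]
      nodup := ht.nodup
      not_ab := by rw [switch_adj_left ha]; exact ht.not_ab
      not_ac := by rw [switch_adj_left ha]; exact ht.not_ac
      not_bc := by rw [switch_adj_left hb]; exact ht.not_bc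
      df := (switch_adj_left hd).2 ht.df
      da := (switch_adj_left hd).2 ht.da
      db := (switch_adj_left hd).2 ht.db
      dc := (switch_adj_left hd).2 ht.dc
      fa := (switch_adj_left hf).2 ht.fa
      fb := (switch_adj_left hf).2 ht.fb
      fc := (switch_adj_left hf).2 ht.fc }
  refine ((h.switch hxy hww' hxw hyw nxw nyw).potWheel_of_edge hIH ht' (x := w) (y := x) hw.1 ?_
    hx.1 ?_ ?_ ?_ ?_).congr (dg_switch hxy hww' hxw hyw nxw nyw)
  · rw [switch_adj_left hu]; exact hw.2
  · rw [switch_adj_left hu]; exact hx.2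
  · exact switch_adj.2 (Or.inl (Or.inr ⟨nxw.symm, Or.inr ⟨rfl, rfl⟩⟩))
  · rw [switch_adj_right hd]; exact xd
  · rwa [switch_adj_right ha, switch_adj_right hb, switch_adj_right hc]

lemma MinDegreeFive.potWheel_of_triangleJoin (h : MinDegreeFive G S u)
    (hIH : SumBound V (S.card - 1)) (ht : TriangleJoin G u a b c d f) : PotWheel G := by
  classical
  by_contra hno
  have hno' : ¬ ∃ f, IsWheel G f := fun h => hno ⟨G, fun _ => rfl, h⟩
  have hN := ht.adj_iff
  have hne := ht.ne
  let R : V → Prop := fun x => u ≠ x ∧ ¬ G.Adj u x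
  have hRne : ∀ {x}, R x → x ≠ a ∧ x ≠ b ∧ x ≠ c ∧ x ≠ d ∧ x ≠ f := by
    intro x hx
    simpa only [hN, not_or] using hx.2
  have hfull : ∀ {x}, R x → G.Adj x a → G.Adj x b → G.Adj x c →
      ¬ G.Adj x d ∧ ¬ G.Adj x f := fun hx xa xb xc =>
    ⟨fun xd => hno' (ht.exists_isWheel hx.1 hx.2 xa xb xd),
      fun xf => hno' (ht.swap.exists_isWheel hx.1 hx.2 xa xb xf)⟩
  have hedge : ∀ {x y}, R x → R y → G.Adj x y → ¬ (G.Adj y d ∧ G.Adj y f) →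
      G.Adj x a ∧ G.Adj x b ∧ G.Adj x c := by
    intro x y hx hy hxy hyd
    by_contra hc
    by_cases yd : G.Adj y d
    · exact hno (h.potWheel_of_edge hIH ht.swap hx.1 hx.2 hy.1 hy.2 hxy
        (fun yf => hyd ⟨yd, yf⟩) hc)
    · exact hno (h.potWheel_of_edge hIH ht hx.1 hx.2 hy.1 hy.2 hxy yd hc)
  have hnbr : ∀ {x}, x ∈ S → R x → ∃ y, R y ∧ G.Adj x y := by
    intro x hxS hx
    by_contra! hc
    have hsub : {w | G.Adj x w} ⊆ (({a, b, c, d, f} : Finset V) : Set V) := by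
      intro w hw
      by_contra hw'
      simp only [coe_insert, coe_singleton, Set.mem_insert_iff, Set.mem_singleton_iff] at hw'
      refine hc w ⟨?_, by rw [hN]; exact hw'⟩ hw
      rintro rfl
      exact hx.2 (SimpleGraph.Adj.symm hw)
    have heq := Set.eq_of_subset_of_ncard_le hsub (by
      rw [Set.ncard_coe_finset]
      exact card_le_five.trans (h.min x hxS)) (Set.toFinite _)
    have hall : ∀ w ∈ ({a, b, c, d, f} : Finset V), G.Adj x w := fun w hw => heq.superset hw
    exact (hfull hx (hall a (by simp)) (hall b (by simp)) (hall c (by simp))).1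
      (hall d (by simp))
  have htype : ∀ {x y}, R x → R y → G.Adj x y →
      ((G.Adj x d ∧ G.Adj x f) ∧ (G.Adj y d ∧ G.Adj y f)) ∨
      ((G.Adj x a ∧ G.Adj x b ∧ G.Adj x c) ∧ (G.Adj y a ∧ G.Adj y b ∧ G.Adj y c)) := by
    intro x y hx hy hxy
    by_cases hyd : G.Adj y d ∧ G.Adj y f
    · by_cases hxd : G.Adj x d ∧ G.Adj x f
      · exact Or.inl ⟨hxd, hyd⟩
      · have hfy := hedge hy hx hxy.symm hxd
        exact ((hfull hy hfy.1 hfy.2.1 hfy.2.2).1 hyd.1).elim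
    · have hfx := hedge hx hy hxy hyd
      exact Or.inr ⟨hfx, hedge hy hx hxy.symm
        fun hxd => (hfull hx hfx.1 hfx.2.1 hfx.2.2).1 hxd.1⟩
  have hmem : ∀ {x y}, G.Adj x y → x ∈ S := fun {x y} hxy => h.mem_of_adj x y hxy
  have hua := ht.ua
  -- some edge outside the closed neighbourhood joins two vertices adjacent to `a`, `b` and `c`
  obtain ⟨x₀, y₀, hx₀, hy₀, hxy₀, hfx₀, hfy₀⟩ : ∃ x y, R x ∧ R y ∧ G.Adj x y ∧
      (G.Adj x a ∧ G.Adj x b ∧ G.Adj x c) ∧ (G.Adj y a ∧ G.Adj y b ∧ G.Adj y c) := by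
    obtain ⟨x, hax, hx⟩ := exists_adj_notMem (G := G) a {u, d, f} (by
      have := h.min a (hmem hua.symm)
      have := card_le_three (a := u) (b := d) (c := f)
      omega)
    simp only [mem_insert, mem_singleton, not_or] at hx
    have hxR : R x := by
      refine ⟨Ne.symm hx.1, ?_⟩
      rw [hN]
      have := ht.not_ab
      have := ht.not_ac
      have := hax.ne
      grind
    obtain ⟨y, hyR, hxy⟩ := hnbr (hmem hax.symm) hxR
    refine ⟨x, y, hxR, hyR, hxy, ?_⟩
    rcases htype hxR hyR hxy with ⟨⟨xd, xf⟩, yd, yf⟩ | h'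
    · exact (hno' (ht.exists_isWheel_of_edge hxR.1 hxR.2 hyR.1 hyR.2 hxy hax.symm xd yd yf)).elim
    · exact h'
  have hall : ∀ {w}, w ∈ S → R w → G.Adj w a ∧ G.Adj w b ∧ G.Adj w c := by
    intro w hwS hw
    by_contra hwf
    obtain ⟨w', hw', hww'⟩ := hnbr hwS hw
    have hP := (htype hw hw' hww').resolve_right fun h' => hwf h'.1
    have hx₀d := hfull hx₀ hfx₀.1 hfx₀.2.1 hfx₀.2.2
    have hy₀d := hfull hy₀ hfy₀.1 hfy₀.2.1 hfy₀.2.2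
    have hxw : ¬ G.Adj x₀ w := fun e =>
      (htype hx₀ hw e).elim (fun h' => hx₀d.1 h'.1.1) fun h' => hwf h'.2
    have hyw : ¬ G.Adj y₀ w' := fun e =>
      (htype hy₀ hw' e).elim (fun h' => hy₀d.1 h'.1.1) fun h' =>
        (hfull hw' h'.2.1 h'.2.2.1 h'.2.2.2).1 hP.2.1
    have nxw : x₀ ≠ w := by rintro rfl; exact hwf hfx₀
    have nyw : y₀ ≠ w' := by rintro rfl; exact hy₀d.1 hP.2.1
    exact hno (h.potWheel_of_two_edges hIH ht hx₀ hy₀ hw hw' hxy₀ hww' hxw hyw nxw nyw hx₀d.1 hwf)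
  have hpick : ∀ T : Finset V, T.card ≤ 3 → ∃ z ∈ S, R z ∧ z ∉ T := by
    intro T hT
    obtain ⟨z, hzS, hz⟩ := exists_mem_notMem_of_card_lt_card (s := {u, a, b, c, d, f} ∪ T) (t := S)
      (by
        have := card_union_le {u, a, b, c, d, f} T
        have := card_le_six (a := u) (b := a) (c := b) (d := c) (e := d) (f := f)
        have := h.card
        omega)
    simp only [mem_union, mem_insert, mem_singleton, not_or] at hz
    refine ⟨z, hzS, ⟨Ne.symm hz.1.1, ?_⟩, hz.2⟩
    rw [hN]
    simpa only [not_or] using hz.1.2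
  have hclique : ∀ {x z}, x ∈ S → R x → z ∈ S → R z → x ≠ z → G.Adj x z := by
    intro x z hxS hx hzS hz hxz
    by_contra hc
    exact hno (ht.potWheel_of_not_adj hx.1 hx.2 hz.1 hz.2 (hall hxS hx).1 (hall hzS hz).2.1 hxz hc)
  obtain ⟨x, hxS, hx, -⟩ := hpick ∅ (by simp)
  obtain ⟨y, hyS, hy, hyx⟩ := hpick {x} (by simp)
  obtain ⟨z, hzS, hz, hzx⟩ := hpick {x, y} (card_le_two.trans (by norm_num))
  obtain ⟨w, hwS, hw, hwx⟩ := hpick {x, y, z} card_le_three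
  simp only [mem_insert, mem_singleton, not_or] at hyx hzx hwx
  have hyne := hRne hy
  have hzne := hRne hz
  have hwne := hRne hw
  refine hno' (_root_.exists_isWheel (h := x) (r₁ := a) (r₂ := y) (r₃ := b) (r₄ := z) (r₅ := w)
    (hall hxS hx).1 (hclique hxS hx hyS hy (Ne.symm hyx)) (hall hxS hx).2.1
    (hclique hxS hx hzS hz (Ne.symm hzx.1)) (hclique hxS hx hwS hw (Ne.symm hwx.1))
    (hall hyS hy).1.symm (hall hyS hy).2.1 (hall hzS hz).2.1.symm
    (hclique hzS hz hwS hw (Ne.symm hwx.2.2)) (hall hwS hw).1 ?_ ?_ ?_ ?_ ?_)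
  all_goals grind

end

section

variable {V : Type*} [Fintype V] {G : SimpleGraph V} {S : Finset V} {u : V}

lemma exists_neighbors_four (h : dg G u = 4) : ∃ a b c d,
    (∀ w, G.Adj u w ↔ w = a ∨ w = b ∨ w = c ∨ w = d) ∧ [a, b, c, d].Nodup := by
  classical
  rw [dg, Set.ncard_eq_toFinset_card', ← length_toList] at h
  have hN : ∀ w, G.Adj u w ↔ w ∈ {w | G.Adj u w}.toFinset.toList := by simp
  have hnd := {w | G.Adj u w}.toFinset.nodup_toList
  match {w | G.Adj u w}.toFinset.toList, h, hN, hnd with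
  | [a, b, c, d], _, hN, hnd => exact ⟨a, b, c, d, by simpa using hN, hnd⟩

lemma exists_neighbors_five (h : dg G u = 5) : ∃ a b c d e,
    (∀ w, G.Adj u w ↔ w = a ∨ w = b ∨ w = c ∨ w = d ∨ w = e) ∧ [a, b, c, d, e].Nodup := by
  classical
  rw [dg, Set.ncard_eq_toFinset_card', ← length_toList] at h
  have hN : ∀ w, G.Adj u w ↔ w ∈ {w | G.Adj u w}.toFinset.toList := by simp
  have hnd := {w | G.Adj u w}.toFinset.nodup_toList
  match {w | G.Adj u w}.toFinset.toList, h, hN, hnd with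
  | [a, b, c, d, e], _, hN, hnd => exact ⟨a, b, c, d, e, by simpa using hN, hnd⟩

omit [Fintype V] in
lemma isClique_insert_four [DecidableEq V] {a b c d : V} (hab : G.Adj a b) (hac : G.Adj a c)
    (had : G.Adj a d) (hbc : G.Adj b c) (hbd : G.Adj b d) (hcd : G.Adj c d) :
    G.IsClique (({a, b, c, d} : Finset V) : Set V) ∧ ({a, b, c, d} : Finset V).card = 4 := by
  refine ⟨?_, ?_⟩
  · simp [SimpleGraph.isClique_insert, *]
  · have := hab.ne; have := hac.ne; have := had.ne
    have := hbc.ne; have := hbd.ne; have := hcd.ne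
    rw [card_insert_of_notMem, card_insert_of_notMem, card_pair] <;> simp_all

lemma potWheel_of_min_degree_four (hS : ∀ v w, G.Adj v w → v ∈ S) (hcard : 10 ≤ S.card)
    (hIH : SumBound V (S.card - 1)) (hmin : ∀ v ∈ S, 4 ≤ dg G v)
    (hsum : 6 * S.card ≤ ∑ v, dg G v + 10) (hu : dg G u = 4) : PotWheel G := by
  classical
  by_contra hno
  have key : ∀ a b c d, (∀ w, G.Adj u w ↔ w = a ∨ w = b ∨ w = c ∨ w = d) →
      [a, b, c, d].Nodup → G.Adj a b := by
    intro a b c d hN hne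
    simp only [List.nodup_cons, List.mem_cons, List.not_mem_nil, not_or, or_false,
      not_false_eq_true, List.nodup_nil, and_true] at hne
    by_contra hab
    exact hno (potWheel_of_degree_four hS hcard hIH hmin hsum hu hN hne.1.1 hne.1.2.1 hne.1.2.2
      hne.2.1.1 hne.2.1.2 hab)
  obtain ⟨a, b, c, d, hN, hne⟩ := exists_neighbors_four hu
  have hperm : ∀ a' b' c' d', [a', b', c', d'].Perm [a, b, c, d] → G.Adj a' b' := by
    intro a' b' c' d' hp
    refine key a' b' c' d' (fun w => ?_) (hp.nodup_iff.2 hne)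
    rw [hN]
    simpa using (hp.mem_iff (a := w)).symm
  have hT := isClique_insert_four (hperm a b c d (.refl _))
    (hperm a c b d (by grind)) (hperm a d b c (by grind)) (hperm b c a d (by grind))
    (hperm b d a c (by grind)) (hperm c d a b (by grind))
  exact hno (potWheel_of_isClique_four hS hcard hIH hmin hsum hu (fun w => by simp [hN]) hT.2 hT.1)

lemma MinDegreeFive.potWheel (h : MinDegreeFive G S u) (hIH : SumBound V (S.card - 1)) :
    PotWheel G := by
  classical
  by_contra hno
  obtain ⟨a, b, c, d, e, hN, hne⟩ := exists_neighbors_five h.dg_eq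
  have hmem : ∀ a' b' c' d' e', [a', b', c', d', e'].Perm [a, b, c, d, e] →
      ∀ w, G.Adj u w ↔ w = a' ∨ w = b' ∨ w = c' ∨ w = d' ∨ w = e' := by
    intro a' b' c' d' e' hp w
    rw [hN]
    simpa using (hp.mem_iff (a := w)).symm
  have hdis : ∀ a' b' c' d' e', [a', b', c', d', e'].Perm [a, b, c, d, e] →
      ¬ G.Adj a' b' → G.Adj c' d' := by
    intro a' b' c' d' e' hp hab
    by_contra hcd
    exact hno (potWheel_of_degree_five h.mem_of_adj h.card hIH h.min h.sum h.dg_eq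
      (hmem _ _ _ _ _ hp)
      (hp.nodup_iff.2 hne) hab hcd)
  have hclique : ∀ a' b' c' d' e', [a', b', c', d', e'].Perm [a, b, c, d, e] →
      G.Adj a' b' → G.Adj a' c' → G.Adj a' d' → G.Adj b' c' → G.Adj b' d' → ¬ G.Adj c' d' := by
    intro a' b' c' d' e' hp hab hac had hbc hbd hcd
    have hT := isClique_insert_four hab hac had hbc hbd hcd
    have hnd := hp.nodup_iff.2 hne
    refine hno (potWheel_of_isClique_five (a := e') h.mem_of_adj h.card hIH h.min h.sum h.dg_eq
      (fun w => ?_) ?_ hT.2 hT.1)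
    · rw [hmem _ _ _ _ _ hp]; simp only [mem_insert, mem_singleton]; tauto
    · simp at hnd ⊢; tauto
  have htri : ∀ a' b' c' d' e', [a', b', c', d', e'].Perm [a, b, c, d, e] →
      ¬ G.Adj a' b' → ¬ G.Adj a' c' → G.Adj b' c' := by
    intro a' b' c' d' e' hp hab hac
    by_contra hbc
    exact hno (h.potWheel_of_triangleJoin hIH
      { adj_iff := hmem _ _ _ _ _ hp
        nodup := hp.nodup_iff.2 hne
        not_ab := hab
        not_ac := hac
        not_bc := hbc
        df := hdis a' b' d' e' c' (.trans (by clear * -; grind) hp) hab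
        da := (hdis b' c' a' d' e' (.trans (by clear * -; grind) hp) hbc).symm
        db := (hdis a' c' b' d' e' (.trans (by clear * -; grind) hp) hac).symm
        dc := (hdis a' b' c' d' e' hp hab).symm
        fa := (hdis b' c' a' e' d' (.trans (by clear * -; grind) hp) hbc).symm
        fb := (hdis a' c' b' e' d' (.trans (by clear * -; grind) hp) hac).symm
        fc := (hdis a' b' c' e' d' (.trans (by clear * -; grind) hp) hab).symm })
  have hadj : ∀ a' b' c' d' e', [a', b', c', d', e'].Perm [a, b, c, d, e] → G.Adj a' b' := by
    intro a' b' c' d' e' hp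
    by_contra hab
    have hac : ∀ c' d' e', [a', b', c', d', e'].Perm [a, b, c, d, e] → G.Adj a' c' := by
      intro c' d' e' hp
      by_contra hac
      exact hclique b' c' d' e' a' (.trans (by clear * -; grind) hp)
        (htri a' b' c' d' e' hp hab hac)
        (hdis a' c' b' d' e' (.trans (by clear * -; grind) hp) hac)
        (hdis a' c' b' e' d' (.trans (by clear * -; grind) hp) hac) (hdis a' b' c' d' e' hp hab)
        (hdis a' b' c' e' d' (.trans (by clear * -; grind) hp) hab)
        (hdis a' b' d' e' c' (.trans (by clear * -; grind) hp) hab)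
    exact hclique a' c' d' e' b' (.trans (by clear * -; grind) hp) (hac c' d' e' hp)
      (hac d' c' e' (.trans (by clear * -; grind) hp))
      (hac e' c' d' (.trans (by clear * -; grind) hp))
      (hdis a' b' c' d' e' hp hab) (hdis a' b' c' e' d' (.trans (by clear * -; grind) hp) hab)
      (hdis a' b' d' e' c' (.trans (by clear * -; grind) hp) hab)
  exact hclique a b c d e (.refl _) (hadj a b c d e (.refl _))
    (hadj a c b d e (by clear * -; grind)) (hadj a d b c e (by clear * -; grind))
    (hadj b c a d e (by clear * -; grind)) (hadj b d a c e (by clear * -; grind))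
    (hadj c d a b e (by clear * -; grind))

end

/-- The edges of `K6C5`, as pairs of natural numbers. -/
def wheelEdges : List (ℕ × ℕ) :=
  [(0, 1), (0, 2), (0, 3), (0, 4), (0, 5), (1, 3), (3, 5), (2, 5), (2, 4), (1, 4)]

lemma mem_wheelEdges_of_adj (a b : Fin 6) (h : K6C5.Adj a b) :
    (a.1, b.1) ∈ wheelEdges ∨ (b.1, a.1) ∈ wheelEdges := by
  rw [K6C5_adj_iff] at h
  revert a b
  decide

/-- The graph on `m` vertices with a given list of edges. -/
def listGraph (m : ℕ) (E : List (ℕ × ℕ)) : SimpleGraph (Fin m) where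
  Adj v w := v ≠ w ∧ ((v.1, w.1) ∈ E ∨ (w.1, v.1) ∈ E)
  symm := ⟨fun _ _ h => ⟨h.1.symm, h.2.symm⟩⟩
  loopless := ⟨fun _ h => h.1 rfl⟩

/-- The list of degrees of `listGraph m E`. -/
def listDegrees (m : ℕ) (E : List (ℕ × ℕ)) : List ℕ :=
  (List.finRange m).map fun v =>
    (List.finRange m).countP fun w => v ≠ w ∧ ((v.1, w.1) ∈ E ∨ (w.1, v.1) ∈ E)

lemma listDegrees_eq (m : ℕ) (E : List (ℕ × ℕ)) :
    listDegrees m E = List.ofFn (dg (listGraph m E)) := by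
  classical
  rw [listDegrees, List.ofFn_eq_map]
  refine List.map_congr_left fun v _ => ?_
  rw [dg, Set.ncard_eq_toFinset_card', List.countP_eq_length_filter,
    ← List.toFinset_card_of_nodup ((List.nodup_finRange m).filter _)]
  congr 1
  ext w
  rw [Set.mem_toFinset, Set.mem_ofPred_eq]
  simp [listGraph]

/-- The descending sequences of length `k` with entries between `lo` and `hi` and sum `s`. -/
def seqs (lo : ℕ) : ℕ → ℕ → ℕ → List (List ℕ)
  | 0, _, s => if s = 0 then [[]] else []
  | k + 1, hi, s => ((List.range (hi + 1)).filter fun x => lo ≤ x ∧ x + k * lo ≤ s).flatMap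
      fun x => (seqs lo k x (s - x)).map (x :: ·)

lemma mem_seqs {lo : ℕ} (l : List ℕ) {hi : ℕ} (hl : l.Pairwise (· ≥ ·))
    (hb : ∀ x ∈ l, lo ≤ x ∧ x ≤ hi) : l ∈ seqs lo l.length hi l.sum := by
  induction l generalizing hi with
  | nil => simp [seqs]
  | cons x l ih =>
    rw [List.pairwise_cons] at hl
    have hx := hb x (by simp)
    have hs := List.card_nsmul_le_sum l lo fun y hy => (hb y (by simp [hy])).1
    simp only [List.length_cons, List.sum_cons, seqs, List.mem_flatMap, List.mem_filter,
      List.mem_range, List.mem_map, decide_eq_true_eq]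
    refine ⟨x, ⟨by omega, hx.1, by simpa using hs⟩, l, ?_, rfl⟩
    rw [Nat.add_sub_cancel_left]
    exact ih hl.2 fun y hy => ⟨(hb y (by simp [hy])).1, hl.1 y hy⟩

/-- Extra edges, on top of `wheelEdges`, of realizations of the descending sequences on seven
vertices not covered by vertex deletion. -/
def extraSeven : List (List (ℕ × ℕ)) := [
  [(1, 2), (1, 6), (2, 6), (3, 4), (3, 6), (5, 6)],
  [(0, 6), (1, 2), (1, 6), (2, 6), (3, 4), (5, 6)],
  [(0, 6), (1, 2), (1, 5), (1, 6), (3, 6), (4, 6)]]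

/-- Extra edges, on top of `wheelEdges`, of realizations of the descending sequences on eight
vertices not covered by vertex deletion. -/
def extraEight : List (List (ℕ × ℕ)) := [
  [(1, 6), (1, 7), (2, 6), (2, 7), (3, 4), (3, 6), (4, 5), (5, 7), (6, 7)],
  [(0, 6), (1, 6), (1, 7), (2, 3), (2, 7), (3, 4), (4, 6), (5, 7), (6, 7)],
  [(0, 6), (1, 2), (1, 6), (1, 7), (2, 7), (3, 6), (3, 7), (4, 5), (6, 7)],
  [(0, 6), (1, 2), (1, 6), (1, 7), (2, 6), (2, 7), (3, 7), (4, 5), (6, 7)],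
  [(0, 6), (0, 7), (1, 6), (1, 7), (2, 3), (2, 6), (3, 7), (4, 5), (6, 7)],
  [(0, 6), (0, 7), (1, 2), (1, 6), (1, 7), (2, 6), (3, 7), (4, 5), (6, 7)],
  [(0, 6), (0, 7), (1, 2), (1, 5), (1, 6), (1, 7), (3, 6), (4, 7), (6, 7)],
  [(1, 6), (1, 7), (2, 6), (2, 7), (3, 6), (3, 7), (4, 5), (4, 6), (5, 7), (6, 7)]]

/-- Extra edges, on top of `wheelEdges`, of realizations of the descending sequences on nine
vertices not covered by vertex deletion. -/
def extraNine : List (List (ℕ × ℕ)) := [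
  [(1, 6), (1, 7), (2, 6), (2, 7), (3, 6), (3, 8), (4, 7), (4, 8), (5, 6), (5, 7), (6, 8), (7, 8)],
  [(0, 6), (1, 6), (1, 7), (2, 6), (2, 8), (3, 7), (3, 8), (4, 5), (4, 6), (5, 7), (6, 8), (7, 8)],
  [(0, 6), (1, 6), (1, 7), (1, 8), (2, 7), (2, 8), (3, 4), (3, 6), (4, 5), (5, 7), (6, 8), (7, 8)],
  [(0, 6), (1, 2), (1, 7), (1, 8), (2, 6), (2, 7), (3, 4), (3, 8), (4, 6), (5, 7), (6, 8), (7, 8)],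
  [(0, 6), (1, 2), (1, 7), (1, 8), (2, 3), (2, 6), (3, 7), (3, 8), (4, 6), (5, 7), (6, 8), (7, 8)],
  [(0, 6), (0, 7), (1, 6), (1, 8), (2, 7), (2, 8), (3, 4), (3, 6), (4, 5), (5, 7), (6, 8), (7, 8)],
  [(0, 6), (0, 7), (1, 6), (1, 7), (1, 8), (2, 3), (2, 8), (3, 4), (4, 6), (5, 7), (6, 8), (7, 8)],
  [(0, 6), (0, 7), (1, 2), (1, 6), (1, 8), (2, 7), (2, 8), (3, 6), (3, 7), (4, 8), (5, 6), (7, 8)],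
  [(0, 6), (0, 7), (1, 2), (1, 6), (1, 7), (1, 8), (2, 8), (3, 6), (3, 7), (4, 8), (5, 6), (7, 8)],
  [(0, 6), (0, 7), (1, 2), (1, 6), (1, 7), (1, 8), (2, 6), (2, 8), (3, 7), (4, 8), (5, 6), (7, 8)],
  [(0, 6), (0, 7), (0, 8), (1, 6), (1, 7), (2, 3), (2, 8), (3, 4), (4, 6), (5, 7), (6, 8), (7, 8)],
  [(0, 6), (0, 7), (0, 8), (1, 6), (1, 7), (1, 8), (2, 3), (2, 6), (3, 7), (4, 8), (5, 6), (7, 8)],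
  [(0, 6), (0, 7), (0, 8), (1, 2), (1, 6), (1, 7), (2, 6), (2, 8), (3, 7), (4, 8), (5, 6), (7, 8)],
  [(0, 6), (0, 7), (0, 8), (1, 2), (1, 6), (1, 7), (1, 8), (2, 6), (3, 7), (4, 8), (5, 6), (7, 8)],
  [(0, 6), (0, 7), (0, 8), (1, 2), (1, 5), (1, 6), (1, 7), (1, 8), (3, 6), (4, 7), (6, 8), (7, 8)],
  [(0, 6), (1, 7), (1, 8), (2, 6), (2, 7), (3, 6), (3, 8), (4, 7), (4, 8), (5, 6), (5, 7),
    (6, 8), (7, 8)]]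

section

variable {V W : Type*} [Fintype V] [Fintype W] {G : SimpleGraph V}

omit [Fintype V] [Fintype W] in
lemma dg_comap (g : W ↪ V) (hg : ∀ v w, G.Adj v w → v ∈ Set.range g) (i : W) :
    dg (G.comap g) i = dg G (g i) := by
  rw [dg, dg, ← Set.ncard_image_of_injective _ g.injective]
  congr 1
  ext w
  simp only [SimpleGraph.comap_adj, Set.mem_image, Set.mem_ofPred_eq]
  constructor
  · rintro ⟨j, hj, rfl⟩
    exact hj
  · intro hw
    obtain ⟨j, rfl⟩ := hg _ _ hw.symm
    exact ⟨j, hw, rfl⟩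

omit [Fintype V] [Fintype W] in
lemma dg_map (g : W ↪ V) (H : SimpleGraph W) (i : W) : dg (H.map g) (g i) = dg H i := by
  rw [dg, dg, ← Set.ncard_image_of_injective {w | H.Adj i w} g.injective]
  congr 1
  ext w
  simp only [SimpleGraph.map_adj, Set.mem_image, Set.mem_ofPred_eq]
  constructor
  · rintro ⟨a, b, hab, ha, rfl⟩
    obtain rfl := g.injective ha
    exact ⟨b, hab, rfl⟩
  · rintro ⟨b, hb, rfl⟩
    exact ⟨i, b, hb, rfl, rfl⟩

omit [Fintype V] in
lemma dg_eq_zero {v : V} (h : ∀ w, ¬ G.Adj v w) : dg G v = 0 := by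
  simp [dg, h]

omit [Fintype V] [Fintype W] in
lemma PotWheel.of_comap (g : W ↪ V) (hg : ∀ v w, G.Adj v w → v ∈ Set.range g)
    (h : PotWheel (G.comap g)) : PotWheel G := by
  obtain ⟨H, hH, f, hf⟩ := h
  refine ⟨H.map g, fun v => ?_, fun i => g (f i), g.injective.comp hf.1,
    fun a b hab => SimpleGraph.map_adj_apply.2 (hf.2 a b hab)⟩
  by_cases hv : v ∈ Set.range g
  · obtain ⟨i, rfl⟩ := hv
    rw [dg_map, hH, dg_comap g hg]
  · rw [dg_eq_zero fun w hw => hv (hg v w hw), dg_eq_zero]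
    intro w hw
    obtain ⟨a, b, -, rfl, -⟩ := (SimpleGraph.map_adj ..).1 hw
    exact hv ⟨a, rfl⟩

lemma sum_dg_comap (g : W ↪ V) (hg : ∀ v w, G.Adj v w → v ∈ Set.range g) :
    ∑ i, dg (G.comap g) i = ∑ v, dg G v := by
  classical
  simp only [dg_comap g hg]
  rw [← sum_map univ g (dg G)]
  refine sum_subset (subset_univ _) fun v _ hv => dg_eq_zero fun w hw => hv ?_
  simpa using hg v w hw

lemma dg_lt_card (v : V) : dg G v < Fintype.card V := by
  classical
  rw [dg_eq_degree]
  exact G.degree_lt_card_verts v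

lemma even_sum_dg : Even (∑ v, dg G v) := by
  classical
  simp only [dg_eq_degree, SimpleGraph.sum_degrees_eq_twice_card_edges, even_two_mul]

omit [Fintype V] in
lemma exists_antitone {S : Finset V} {m : ℕ} (hc : S.card = m) (d : V → ℕ) :
    ∃ g : Fin m ↪ V, Set.range g = S ∧ Antitone fun i => d (g i) := by
  let e : Fin m ≃ S := (S.equivFinOfCardEq hc).symm
  let σ := Tuple.sort fun i => OrderDual.toDual (d (e i))
  refine ⟨(σ.trans e).toEmbedding.trans (Function.Embedding.subtype _), ?_,
    fun i j hij => Tuple.monotone_sort (fun i => OrderDual.toDual (d (e i))) hij⟩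
  ext v
  refine ⟨?_, fun hv => ⟨σ.symm (e.symm ⟨v, hv⟩), by simp⟩⟩
  rintro ⟨i, rfl⟩
  exact (e (σ i)).2

end

lemma potWheel_of_mem_seqs {m lo s : ℕ} (hm : 6 ≤ m) {T : List (List (ℕ × ℕ))}
    (hT : ∀ l ∈ seqs lo m (m - 1) s, ∃ E ∈ T, listDegrees m (wheelEdges ++ E) = l)
    {V : Type*} [Fintype V] {G : SimpleGraph V} {S : Finset V} (hc : S.card = m)
    (hS : ∀ v w, G.Adj v w → v ∈ S) (hlo : ∀ v ∈ S, lo ≤ dg G v) (hs : ∑ v, dg G v = s) :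
    PotWheel G := by
  obtain ⟨g, hgS, hanti⟩ := exists_antitone hc (dg G)
  have hg : ∀ v w, G.Adj v w → v ∈ Set.range g := fun v w h => by rw [hgS]; exact hS v w h
  refine .of_comap g hg ?_
  simp only [← dg_comap g hg] at hanti
  have hmem : List.ofFn (dg (G.comap g)) ∈ seqs lo m (m - 1) s := by
    have := mem_seqs (lo := lo) (List.ofFn (dg (G.comap g))) (hi := m - 1)
      (List.pairwise_ofFn.2 fun i j hij => hanti hij.le) (by
        simp only [List.mem_ofFn, forall_exists_index, forall_apply_eq_imp_iff]
        intro i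
        have h₁ := dg_lt_card (G := G.comap g) i
        rw [Fintype.card_fin] at h₁
        rw [dg_comap g hg] at h₁ ⊢
        exact ⟨hlo _ (by rw [← mem_coe, ← hgS]; exact ⟨i, rfl⟩), by omega⟩)
    rwa [List.length_ofFn, List.sum_ofFn, sum_dg_comap g hg, hs] at this
  obtain ⟨E, -, hE⟩ := hT _ hmem
  rw [listDegrees_eq] at hE
  refine ⟨_, fun i => congrFun (List.ofFn_injective hE) i, Fin.castLE hm,
    Fin.castLE_injective hm, fun a b hab => ⟨fun h => hab.ne (Fin.castLE_injective hm h), ?_⟩⟩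
  exact (mem_wheelEdges_of_adj a b hab).imp (List.mem_append_left _) (List.mem_append_left _)

lemma seqs_seven : ∀ l ∈ seqs 4 7 6 32,
    ∃ E ∈ extraSeven, listDegrees 7 (wheelEdges ++ E) = l := by
  decide +kernel

lemma seqs_eight : ∀ l ∈ seqs 4 8 7 38 ++ seqs 5 8 7 40,
    ∃ E ∈ extraEight, listDegrees 8 (wheelEdges ++ E) = l := by
  decide +kernel

lemma seqs_nine : ∀ l ∈ seqs 4 9 8 44 ++ seqs 5 9 8 46,
    ∃ E ∈ extraNine, listDegrees 9 (wheelEdges ++ E) = l := by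
  decide +kernel
/-- Placements of `K6C5` on six vertices; any two pairs of vertices are avoided by one of them. -/
def placements : List (Fin 6 → Fin 6) := [
  ![0, 1, 2, 3, 4, 5], ![0, 1, 3, 5, 2, 4], ![1, 0, 2, 3, 5, 4], ![1, 0, 3, 2, 4, 5],
  ![2, 0, 1, 4, 3, 5], ![3, 0, 1, 5, 2, 4], ![4, 0, 2, 1, 5, 3], ![2, 0, 4, 3, 1, 5],
  ![0, 1, 3, 2, 5, 4], ![3, 0, 4, 1, 2, 5], ![5, 0, 1, 3, 4, 2], ![1, 0, 2, 5, 4, 3],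
  ![5, 0, 3, 1, 2, 4], ![2, 0, 1, 4, 5, 3], ![3, 0, 2, 4, 1, 5], ![4, 0, 1, 2, 3, 5]]

lemma exists_placement (x y : Sym2 (Fin 6)) : ∃ σ ∈ placements, Function.Injective σ ∧
    ∀ a b : Fin 6, (a.1, b.1) ∈ wheelEdges → s(σ a, σ b) ≠ x ∧ s(σ a, σ b) ≠ y := by
  induction x with | _ p q
  induction y with | _ r t
  revert p q r t
  decide +kernel

lemma exists_isWheel_of_le_sum (G : SimpleGraph (Fin 6)) (h : 26 ≤ ∑ v, dg G v) :
    ∃ f, IsWheel G f := by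
  classical
  have hcard : Gᶜ.edgeFinset.card ≤ 2 := by
    have h₁ := Gᶜ.sum_degrees_eq_twice_card_edges
    have h₂ : ∑ v, dg G v + ∑ v, Gᶜ.degree v = 30 := by
      rw [← sum_add_distrib]
      have : ∀ v ∈ (univ : Finset (Fin 6)), dg G v + Gᶜ.degree v = 5 := fun v _ => by
        have := dg_lt_card (G := G) v
        rw [Fintype.card_fin] at this
        rw [SimpleGraph.degree_compl, ← dg_eq_degree, Fintype.card_fin]
        omega
      rw [sum_congr rfl this]
      simp
    omega
  obtain ⟨t, ht, htc⟩ := exists_superset_card_eq hcard (by decide)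
  obtain ⟨x, y, -, rfl⟩ := card_eq_two.1 htc
  obtain ⟨σ, -, hσ, hxy⟩ := exists_placement x y
  have key : ∀ a b : Fin 6, a ≠ b → (a.1, b.1) ∈ wheelEdges → G.Adj (σ a) (σ b) := by
    intro a b hne hab
    by_contra hc
    have hmem := ht (SimpleGraph.mem_edgeFinset.2 (show s(σ a, σ b) ∈ Gᶜ.edgeSet from
      (G.compl_adj _ _).2 ⟨hσ.ne hne, hc⟩))
    rw [mem_insert, mem_singleton] at hmem
    exact hmem.elim (hxy a b hab).1 (hxy a b hab).2
  exact ⟨σ, hσ, fun a b hab => (mem_wheelEdges_of_adj a b hab).elim (key a b hab.ne)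
    fun h => (key b a hab.ne' h).symm⟩

lemma sumBound_six (V : Type*) [Fintype V] : SumBound V 6 := by
  intro G S hc hS hs
  obtain ⟨g, hgS, -⟩ := exists_antitone hc (dg G)
  have hg : ∀ v w, G.Adj v w → v ∈ Set.range g := fun v w h => by rw [hgS]; exact hS v w h
  refine .of_comap g hg ⟨_, fun _ => rfl, exists_isWheel_of_le_sum _ ?_⟩
  rw [sum_dg_comap g hg]
  omega

theorem sumBound (V : Type*) [Fintype V] (m : ℕ) (hm : 6 ≤ m) : SumBound V m := by
  induction m, hm using Nat.le_induction with
  | base => exact sumBound_six V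
  | succ m hm ih =>
    intro G S hc hS hs
    have hIH : SumBound V (S.card - 1) := by rwa [hc]
    by_cases hdel : ∃ u ∈ S, 6 * S.card + 2 * dg G u ≤ ∑ v, dg G v + 16
    · obtain ⟨u, hu, hsum⟩ := hdel
      obtain ⟨H, f, hH, -, hf, -⟩ := hIH.exists_wheel_notMem hu hS hsum
      exact ⟨H, hH, f, hf⟩
    push Not at hdel
    obtain ⟨u, hu, hmin⟩ := S.exists_min_image (dg G) (card_pos.1 (by omega))
    have hsum : S.card * dg G u ≤ ∑ v, dg G v :=
      (card_nsmul_le_sum S (dg G) _ hmin).trans (sum_le_sum_of_subset (subset_univ S))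
    have hu' := hdel u hu
    obtain ⟨k, hk⟩ := even_sum_dg (G := G)
    rw [← hc] at hs
    have hlo : 4 ≤ dg G u := by omega
    have hhi : dg G u ≤ 5 := by
      by_contra! h
      nlinarith
    obtain h4 | h5 : dg G u = 4 ∨ dg G u = 5 := by omega
    · rw [h4] at hmin hsum
      by_cases h10 : 10 ≤ S.card
      · exact potWheel_of_min_degree_four hS h10 hIH hmin hs h4
      obtain rfl | rfl | rfl : m = 6 ∨ m = 7 ∨ m = 8 := by omega
      · exact potWheel_of_mem_seqs (by norm_num) seqs_seven hc hS hmin (by omega)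
      · exact potWheel_of_mem_seqs (by norm_num)
          (fun l hl => seqs_eight l (List.mem_append_left _ hl)) hc hS hmin (by omega)
      · exact potWheel_of_mem_seqs (by norm_num)
          (fun l hl => seqs_nine l (List.mem_append_left _ hl)) hc hS hmin (by omega)
    · rw [h5] at hmin hsum
      by_cases h10 : 10 ≤ S.card
      · exact MinDegreeFive.potWheel ⟨hS, h10, hmin, hs, h5⟩ hIH
      obtain rfl | rfl | rfl : m = 6 ∨ m = 7 ∨ m = 8 := by omega
      · omega
      · exact potWheel_of_mem_seqs (by norm_num)
          (fun l hl => seqs_eight l (List.mem_append_right _ hl)) hc hS hmin (by omega)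
      · exact potWheel_of_mem_seqs (by norm_num)
          (fun l hl => seqs_nine l (List.mem_append_right _ hl)) hc hS hmin (by omega)

theorem sigma_K6C5 (n : ℕ) (hn : 6 ≤ n) (l : List ℕ) (hlen : l.length = n)
    (hpos : ∀ x ∈ l, 0 < x) (hg : IsGraphic l) (hsum : 6 * n - 10 ≤ l.sum) :
    PotentiallyK6C5 l := by
  obtain ⟨G, hG⟩ := hg
  have hs : ∑ v, dg G v = l.sum := by
    rw [← Fin.sum_univ_getElem]
    exact sum_congr rfl fun i _ => hG i
  obtain ⟨H, hH, f, hf⟩ := sumBound (Fin l.length) l.length (hlen ▸ hn) G univ (by simp)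
    (fun v _ _ => mem_univ v) (by omega)
  exact ⟨H, fun i => (hH i).trans (hG i), f, hf⟩
end

section
/- For every n ≥ 6, the sequence π = ((n−1)^3, 3^{n−3}) (three terms equal to n−1 followed by n−3 terms equal to 3) is a graphic sequence with σ(π) = 6n − 12 that is not potentially K6−C5-graphic. Consequently, 6n − 10 is the smallest even integer m such that every graphic sequence of n positive integers with sum at least m is potentially K6−C5-graphic. -/
/-- The graph `G` contains a copy of `K₆ − C₅`. -/
def ContainsK6C5 {N : ℕ} (G : SimpleGraph (Fin N)) : Prop :=
  ∃ f : Fin 6 → Fin N, Function.Injective f ∧ ∀ a b : Fin 6, K6C5.Adj a b → G.Adj (f a) (f b)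

/-- Some graph with the same vertex degrees as `G` contains a copy of `K₆ − C₅`. -/
def DegreeForcesK6C5 {N : ℕ} (G : SimpleGraph (Fin N)) : Prop :=
  ∃ H : SimpleGraph (Fin N), (∀ i, degCount H i = degCount G i) ∧ ContainsK6C5 H

instance : DecidableRel K6C5.Adj := fun a b => by
  unfold K6C5 SimpleGraph.fromRel
  infer_instance

namespace SimpleGraph

variable {N : ℕ} {G H : SimpleGraph (Fin N)} {u v x y : Fin N}

/-- The finset of neighbours of `v`. -/
noncomputable def nbrs (G : SimpleGraph (Fin N)) (v : Fin N) : Finset (Fin N) := by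
  classical exact Finset.univ.filter (G.Adj v)

@[simp]
theorem mem_nbrs : u ∈ G.nbrs v ↔ G.Adj v u := by
  simp [nbrs]

theorem card_nbrs (G : SimpleGraph (Fin N)) (v : Fin N) : (G.nbrs v).card = degCount G v := by
  rw [degCount, ← Set.ncard_coe_finset]
  congr 1
  ext u
  simp

theorem even_sum_degCount (G : SimpleGraph (Fin N)) : Even (∑ i, degCount G i) := by
  classical
  have h : ∀ i, degCount G i = G.degree i := fun i => by
    rw [← card_nbrs, ← card_neighborFinset_eq_degree]
    congr 1
    ext u
    simp
  simp [h, sum_degrees_eq_twice_card_edges]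

theorem exists_adj_notMem (F : Finset (Fin N)) (h : F.card < degCount G v) :
    ∃ s, G.Adj v s ∧ s ∉ F := by
  rw [← card_nbrs] at h
  obtain ⟨s, hs, hF⟩ := Finset.exists_mem_notMem_of_card_lt_card h
  exact ⟨s, mem_nbrs.1 hs, hF⟩

theorem degCount_sup (h : ∀ a b, G.Adj a b → ¬ H.Adj a b) :
    degCount (G ⊔ H) v = degCount G v + degCount H v := by
  classical
  simp only [← card_nbrs]
  rw [← Finset.card_union_of_disjoint]
  · congr 1
    ext u
    simp
  · rw [Finset.disjoint_left]
    intro u hu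
    simpa using h v u (by simpa using hu)

theorem degCount_edge (h : x ≠ y) :
    degCount (edge x y) v = (if v = x then 1 else 0) + if v = y then 1 else 0 := by
  rw [← card_nbrs]
  by_cases hx : v = x
  · subst hx
    rw [show (edge v y).nbrs v = {y} by ext u; simp [edge_adj]; grind]
    simp [h]
  by_cases hy : v = y
  · subst hy
    rw [show (edge x v).nbrs v = {x} by ext u; simp [edge_adj]; grind]
    simp [hx]
  · rw [show (edge x y).nbrs v = ∅ by ext u; simp [edge_adj]; grind]
    simp [hx, hy]

theorem degCount_sup_edge (h : x ≠ y) (hG : ¬ G.Adj x y) :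
    degCount (G ⊔ edge x y) v =
      degCount G v + ((if v = x then 1 else 0) + if v = y then 1 else 0) := by
  rw [degCount_sup, degCount_edge h]
  intro a b hab
  rw [edge_adj]
  rintro ⟨⟨rfl, rfl⟩ | ⟨rfl, rfl⟩, -⟩
  exacts [hG hab, hG hab.symm]

theorem degCount_sdiff_edge (hG : G.Adj x y) :
    degCount (G \ edge x y) v + ((if v = x then 1 else 0) + if v = y then 1 else 0) =
      degCount G v := by
  rw [← degCount_sup_edge hG.ne (by simp [edge_adj, hG.ne])]
  congr 1
  ext a b
  simp only [sup_adj, sdiff_adj, edge_adj]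
  grind [SimpleGraph.adj_comm, SimpleGraph.Adj.ne]

theorem degCount_deleteIncidenceSet (h : u ≠ v) :
    degCount (G.deleteIncidenceSet v) u + (if u ∈ G.nbrs v then 1 else 0) = degCount G u := by
  simp only [← card_nbrs]
  rw [show (G.deleteIncidenceSet v).nbrs u = (G.nbrs u).erase v by
    ext w; simp [deleteIncidenceSet_adj, h]; tauto]
  split_ifs with hu
  · exact Finset.card_erase_add_one (by simpa [adj_comm] using hu)
  · rw [Finset.erase_eq_of_notMem (by simpa [adj_comm] using hu), add_zero]

theorem degCount_eq_zero (h : ∀ u, ¬ G.Adj v u) : degCount G v = 0 := by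
  simp [degCount, h]

theorem not_adj_of_degCount_eq_zero (h : degCount G v = 0) (u : Fin N) : ¬ G.Adj v u := by
  rw [← card_nbrs, Finset.card_eq_zero] at h
  rw [← mem_nbrs, h]
  simp

/-- The star with centre `v` and set of leaves `T`. -/
def spokes (v : Fin N) (T : Finset (Fin N)) : SimpleGraph (Fin N) :=
  SimpleGraph.fromRel fun a b => a = v ∧ b ∈ T

theorem degCount_sup_spokes {T : Finset (Fin N)} (hv : v ∉ T) (h : ∀ u, ¬ G.Adj v u) :
    degCount (G ⊔ spokes v T) u =
      degCount G u + if u = v then T.card else if u ∈ T then 1 else 0 := by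
  rw [degCount_sup]
  · congr 1
    rw [← card_nbrs]
    split_ifs with h1 h2
    · subst h1
      congr 1
      ext w
      simp [spokes]
      grind
    · rw [show (spokes v T).nbrs u = {v} by ext w; simp [spokes]; grind]
      simp
    · rw [show (spokes v T).nbrs u = ∅ by ext w; simp [spokes]; grind]
      simp
  · intro a b hab
    have := h b
    have := h a
    simp only [spokes, fromRel_adj]
    grind [SimpleGraph.adj_comm]

/-- The switch replacing the edges `va`, `pq` by `vp`, `aq`. -/
def switch (G : SimpleGraph (Fin N)) (v a p q : Fin N) : SimpleGraph (Fin N) :=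
  ((G \ edge v a) \ edge p q) ⊔ edge v p ⊔ edge a q

theorem switch_adj {a p q s t : Fin N} (hs : s ≠ v) (ht : t ≠ v) (hsq : s ≠ q) (htq : t ≠ q) :
    (G.switch v a p q).Adj s t ↔ G.Adj s t := by
  simp only [switch, sup_adj, sdiff_adj, edge_adj]
  grind

theorem nbrs_switch {a p q : Fin N} (hva : G.Adj v a) (hne : v ≠ p) (hvq' : v ≠ q) :
    (G.switch v a p q).nbrs v = insert p ((G.nbrs v).erase a) := by
  ext t
  simp only [switch, mem_nbrs, sup_adj, sdiff_adj, edge_adj, Finset.mem_insert, Finset.mem_erase]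
  grind [SimpleGraph.Adj.ne]

theorem degCount_switch {a p q : Fin N} (hva : G.Adj v a) (hpq : G.Adj p q) (hvp : ¬ G.Adj v p)
    (haq : ¬ G.Adj a q) (hvq : ¬ G.Adj v q) (hne : v ≠ p) (hvq' : v ≠ q) (i : Fin N) :
    degCount (G.switch v a p q) i = degCount G i := by
  have hva' := hva.ne
  have hap : a ≠ p := by rintro rfl; exact hvp hva
  have haq' : a ≠ q := by rintro rfl; exact hvq hva
  have h1 := degCount_sdiff_edge (v := i) hva
  have h2 := degCount_sdiff_edge (G := G \ edge v a) (v := i) (x := p) (y := q)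
    (by simp [sdiff_adj, edge_adj, hpq]; grind)
  have h3 := degCount_sup_edge (G := (G \ edge v a) \ edge p q) (v := i) hne
    (by simp [sdiff_adj, hvp])
  have h4 := degCount_sup_edge (G := ((G \ edge v a) \ edge p q) ⊔ edge v p) (v := i) haq'
    (by simp [sdiff_adj, edge_adj, haq]; grind)
  rw [switch]
  omega

/-- A hub adjacent to all vertices of a 5-cycle gives a copy of `K₆ − C₅`. -/
theorem containsK6C5_of_wheel {h a b c d e : Fin N} (ha : G.Adj h a) (hb : G.Adj h b)
    (hc : G.Adj h c) (hd : G.Adj h d) (he : G.Adj h e) (hab : G.Adj a b) (hbc : G.Adj b c)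
    (hcd : G.Adj c d) (hde : G.Adj d e) (hea : G.Adj e a) (hac : a ≠ c) (had : a ≠ d)
    (hbd : b ≠ d) (hbe : b ≠ e) (hce : c ≠ e) : ContainsK6C5 G := by
  refine ⟨![h, a, d, b, e, c], ?_, ?_⟩
  · have := ha.ne
    have := hb.ne
    have := hc.ne
    have := hd.ne
    have := he.ne
    have := hab.ne
    have := hbc.ne
    have := hcd.ne
    have := hde.ne
    have := hea.ne
    intro i j hij
    fin_cases i <;> fin_cases j <;> simp at hij ⊢ <;> grind
  · intro i j hij
    fin_cases i <;> fin_cases j <;>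
      first
      | exact absurd hij (by decide)
      | (simp; first | assumption | (apply SimpleGraph.Adj.symm; assumption))

theorem _root_.ContainsK6C5.mono (hGH : ∀ a b, G.Adj a b → H.Adj a b) (h : ContainsK6C5 G) :
    ContainsK6C5 H := by
  obtain ⟨f, hf, hfG⟩ := h
  exact ⟨f, hf, fun a b hab => hGH _ _ (hfG a b hab)⟩

theorem _root_.DegreeForcesK6C5.of_eq (hGH : ∀ i, degCount H i = degCount G i)
    (h : DegreeForcesK6C5 H) : DegreeForcesK6C5 G := by
  obtain ⟨K, hK, hw⟩ := h
  exact ⟨K, fun i => (hK i).trans (hGH i), hw⟩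

theorem containsK6C5_of_clique {p : Fin N} {A : Finset (Fin N)} (hA : A.card = 4)
    (hclique : ∀ a ∈ A, ∀ b ∈ A, a ≠ b → G.Adj a b) (hv : ∀ a ∈ A, G.Adj v a)
    (hp : ∀ a ∈ A, G.Adj p a) (hne : v ≠ p) : ContainsK6C5 G := by
  obtain ⟨a, ha⟩ : A.Nonempty := Finset.card_pos.1 (by omega)
  obtain ⟨b, c, d, hbc, hbd, hcd, hE⟩ := Finset.card_eq_three.1
    (show (A.erase a).card = 3 by rw [Finset.card_erase_of_mem ha]; omega)
  have hmem : ∀ t, t = b ∨ t = c ∨ t = d → t ∈ A ∧ t ≠ a := fun t ht => by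
    have : t ∈ A.erase a := by rw [hE]; simpa using ht
    grind
  have hb := hmem b (by simp)
  have hc := hmem c (by simp)
  have hd := hmem d (by simp)
  apply containsK6C5_of_wheel (h := a) (a := v) (b := b) (c := p) (d := c) (e := d) <;>
    grind [SimpleGraph.adj_comm, SimpleGraph.Adj.ne]

theorem containsK6C5_or_exists_not_adj {p q : Fin N} {A : Finset (Fin N)} (hA : A.card = 4)
    (hclique : ∀ a ∈ A, ∀ b ∈ A, a ≠ b → G.Adj a b) (hv : ∀ a ∈ A, G.Adj v a)
    (hpq : G.Adj p q) (hvp : v ≠ p) (hvq : v ≠ q) :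
    ContainsK6C5 G ∨ ∃ a ∈ A, ∃ b ∈ A, a ≠ b ∧ ¬ G.Adj q a ∧ ¬ G.Adj p b := by
  by_cases hp : ∀ a ∈ A, G.Adj p a
  · exact .inl (containsK6C5_of_clique hA hclique hv hp hvp)
  by_cases hq : ∀ a ∈ A, G.Adj q a
  · exact .inl (containsK6C5_of_clique hA hclique hv hq hvq)
  push Not at hp hq
  obtain ⟨b, hb, hpb⟩ := hp
  by_cases hall : ∀ a ∈ A, a ≠ b → G.Adj q a
  swap
  · push Not at hall
    obtain ⟨a, ha, hab, hqa⟩ := hall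
    exact .inr ⟨a, ha, b, hb, hab, hqa, hpb⟩
  obtain ⟨a, ha, hqa⟩ := hq
  obtain rfl : a = b := by
    by_contra h
    exact hqa (hall a ha h)
  by_cases hall' : ∀ c ∈ A, c ≠ a → G.Adj p c
  swap
  · push Not at hall'
    obtain ⟨c, hc, hca, hpc⟩ := hall'
    exact .inr ⟨a, ha, c, hc, hca.symm, hqa, hpc⟩
  left
  obtain ⟨b, c, d, hbc, hbd, hcd, hE⟩ := Finset.card_eq_three.1
    (show (A.erase a).card = 3 by rw [Finset.card_erase_of_mem ha]; omega)
  have hmem : ∀ t, t = b ∨ t = c ∨ t = d → t ∈ A ∧ t ≠ a := fun t ht => by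
    have : t ∈ A.erase a := by rw [hE]; simpa using ht
    grind
  have hb := hmem b (by simp)
  have hc := hmem c (by simp)
  have hd := hmem d (by simp)
  apply containsK6C5_of_wheel (h := b) (a := a) (b := c) (c := p) (d := q) (e := d) <;>
    grind [SimpleGraph.adj_comm, SimpleGraph.Adj.ne]

/-- Every vertex outside a closed neighbourhood either sees all of the neighbourhood or has a
neighbour outside. -/
theorem forall_adj_or_exists_adj {r : Fin N} (h : degCount G v ≤ degCount G r)
    (hvr : ¬ G.Adj v r) :
    (∀ t ∈ G.nbrs v, G.Adj r t) ∨ ∃ q, G.Adj r q ∧ ¬ G.Adj v q ∧ v ≠ q := by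
  by_cases hsub : G.nbrs r ⊆ G.nbrs v
  · left
    rw [← Finset.eq_of_subset_of_card_le hsub (by rwa [card_nbrs, card_nbrs])]
    exact fun t ht => mem_nbrs.1 ht
  · right
    obtain ⟨q, hq, hqv⟩ := Finset.not_subset.1 hsub
    simp only [mem_nbrs] at hq hqv
    refine ⟨q, hq, hqv, ?_⟩
    rintro rfl
    exact hvr hq.symm

theorem exists_mem_not_adj {S : Finset (Fin N)} (h : degCount G v + 1 < S.card) :
    ∃ r ∈ S, r ≠ v ∧ ¬ G.Adj v r := by
  have h' : (insert v (G.nbrs v)).card < S.card :=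
    (Finset.card_insert_le _ _).trans_lt (by rwa [card_nbrs])
  obtain ⟨r, hr, hrv⟩ := Finset.exists_mem_notMem_of_card_lt_card h'
  exact ⟨r, hr, by grind, by simp at hrv; exact hrv.2⟩

theorem exists_not_adj_of_degCount_eq_four {S : Finset (Fin N)} (hS : 6 ≤ S.card)
    (h4 : degCount G v = 4) (hmin : ∀ u ∈ S, 4 ≤ degCount G u) :
    ContainsK6C5 G ∨ ∃ G' : SimpleGraph (Fin N), (∀ i, degCount G' i = degCount G i) ∧
      ∃ x y, G'.Adj v x ∧ G'.Adj v y ∧ x ≠ y ∧ ¬ G'.Adj x y := by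
  by_cases hclique : ∀ a ∈ G.nbrs v, ∀ b ∈ G.nbrs v, a ≠ b → G.Adj a b
  swap
  · push Not at hclique
    obtain ⟨x, hx, y, hy, hxy, h⟩ := hclique
    exact .inr ⟨G, fun _ => rfl, x, y, by simpa using hx, by simpa using hy, hxy, h⟩
  have hA : (G.nbrs v).card = 4 := by rw [card_nbrs, h4]
  have hv : ∀ a ∈ G.nbrs v, G.Adj v a := fun a ha => by simpa using ha
  obtain ⟨p, hpS, hpv, hvp⟩ := exists_mem_not_adj (G := G) (v := v) (S := S) (by omega)
  obtain hp | ⟨q, hpq, hvq, hqv⟩ :=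
    forall_adj_or_exists_adj (G := G) (h4.trans_le (hmin p hpS)) hvp
  · exact .inl (containsK6C5_of_clique hA hclique hv hp hpv.symm)
  obtain h | ⟨a, ha, b, hb, hab, hqa, hpb⟩ :=
    containsK6C5_or_exists_not_adj hA hclique hv hpq hpv.symm hqv
  · exact .inl h
  right
  refine ⟨G.switch v a p q, degCount_switch (hv a ha) hpq hvp (fun h => hqa h.symm) hvq
    hpv.symm hqv, p, b, ?_, ?_, ?_, ?_⟩
  · rw [← mem_nbrs, nbrs_switch (hv a ha) hpv.symm hqv]
    simp
  · rw [← mem_nbrs, nbrs_switch (hv a ha) hpv.symm hqv]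
    grind
  · rintro rfl
    exact hvp (hv _ hb)
  · rw [switch_adj hpv (hv b hb).ne' hpq.ne (by rintro rfl; exact hvq (hv _ hb))]
    exact hpb

/-- The neighbourhood of `v` contains two disjoint pairs of nonadjacent vertices. -/
def TwoNonedges (G : SimpleGraph (Fin N)) (v : Fin N) : Prop :=
  ∃ x y z w, (x ∈ G.nbrs v ∧ y ∈ G.nbrs v ∧ z ∈ G.nbrs v ∧ w ∈ G.nbrs v) ∧
    (x ≠ y ∧ x ≠ z ∧ x ≠ w ∧ y ≠ z ∧ y ≠ w ∧ z ≠ w) ∧ ¬ G.Adj x y ∧ ¬ G.Adj z w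

theorem twoNonedges_switch {a p q x z w : Fin N} (hva : G.Adj v a) (hpq : G.Adj p q)
    (hvp : ¬ G.Adj v p) (hvq : ¬ G.Adj v q) (hne : v ≠ p) (hvq' : v ≠ q)
    (hx : G.Adj v x) (hz : G.Adj v z) (hw : G.Adj v w) (hxa : x ≠ a) (hza : z ≠ a) (hwa : w ≠ a)
    (hxz : x ≠ z) (hxw : x ≠ w) (hzw : z ≠ w) (hpx : ¬ G.Adj p x) (hzw' : ¬ G.Adj z w) :
    (G.switch v a p q).TwoNonedges v := by
  refine ⟨p, x, z, w, ?_, ?_, ?_, ?_⟩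
  · rw [nbrs_switch hva hne hvq']
    simp_all
  · grind
  · rw [switch_adj hne.symm hx.ne' hpq.ne (by grind)]
    exact hpx
  · rw [switch_adj hz.ne' hw.ne' (by grind) (by grind)]
    exact hzw'

theorem nbrs_structure_of_not_twoNonedges (h5 : (G.nbrs v).card = 5) (h : ¬ G.TwoNonedges v) :
    (∃ c ∈ G.nbrs v, ∀ a ∈ (G.nbrs v).erase c, ∀ b ∈ (G.nbrs v).erase c, a ≠ b → G.Adj a b) ∨
    ∃ x y a b c, G.nbrs v = {x, y, a, b, c} ∧ [x, y, a, b, c].Nodup ∧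
      G.Adj x y ∧ (∀ t ∈ [a, b, c], G.Adj x t ∧ G.Adj y t) ∧
      ¬ G.Adj a b ∧ ¬ G.Adj a c ∧ ¬ G.Adj b c := by
  have key : ∀ x ∈ G.nbrs v, ∀ y ∈ G.nbrs v, ∀ z ∈ G.nbrs v, ∀ w ∈ G.nbrs v,
      x ≠ y → x ≠ z → x ≠ w → y ≠ z → y ≠ w → z ≠ w → ¬ G.Adj x y → G.Adj z w := by
    intro x hx y hy z hz w hw h1 h2 h3 h4 h5 h6 hxy
    by_contra hzw
    exact h ⟨x, y, z, w, ⟨hx, hy, hz, hw⟩, ⟨h1, h2, h3, h4, h5, h6⟩, hxy, hzw⟩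
  rw [or_iff_not_imp_left]
  intro hbad
  push Not at hbad
  obtain ⟨c₀, hc₀⟩ : (G.nbrs v).Nonempty := Finset.card_pos.1 (by omega)
  obtain ⟨a, ha, b, hb, hab, hnab⟩ := hbad c₀ hc₀
  obtain ⟨ha, hb⟩ := And.intro (Finset.mem_of_mem_erase ha) (Finset.mem_of_mem_erase hb)
  obtain ⟨b₁, hb₁, c, hc, hbc, hnbc⟩ := hbad a ha
  obtain ⟨c₁, hc₁, d₁, hd₁, hcd, hncd⟩ := hbad b hb
  clear hbad
  obtain ⟨c, hc, hca, hcb, hnbc⟩ : ∃ c ∈ G.nbrs v, c ≠ a ∧ c ≠ b ∧ ¬ G.Adj b c := by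
    rw [Finset.mem_erase] at hb₁ hc
    by_cases h1 : b₁ = b
    · exact ⟨c, hc.2, hc.1, by grind, by grind⟩
    by_cases h2 : c = b
    · exact ⟨b₁, hb₁.2, hb₁.1, h1, fun h => hnbc (h2 ▸ h.symm)⟩
    exact absurd (key a ha b hb b₁ hb₁.2 c hc.2 hab hb₁.1.symm hc.1.symm (Ne.symm h1) (Ne.symm h2)
      hbc hnab) hnbc
  obtain ⟨d, hd, hda, hdb, hnad⟩ : ∃ d ∈ G.nbrs v, d ≠ a ∧ d ≠ b ∧ ¬ G.Adj a d := by
    rw [Finset.mem_erase] at hc₁ hd₁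
    by_cases h1 : c₁ = a
    · exact ⟨d₁, hd₁.2, by grind, hd₁.1, by grind⟩
    by_cases h2 : d₁ = a
    · exact ⟨c₁, hc₁.2, h1, hc₁.1, fun h => hncd (h2 ▸ h.symm)⟩
    exact absurd (key a ha b hb c₁ hc₁.2 d₁ hd₁.2 hab (Ne.symm h1) (Ne.symm h2) hc₁.1.symm
      hd₁.1.symm hcd hnab) hncd
  have hnac : ¬ G.Adj a c := by
    by_cases hdc : d = c
    · rwa [← hdc]
    · exact fun _ => hnbc (key a ha d hd b hb c hc hda.symm hab hca.symm hdb hdc hcb.symm hnad)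
  obtain ⟨x, y, hxy, hE⟩ := Finset.card_eq_two.1
    (show ((((G.nbrs v).erase a).erase b).erase c).card = 2 by
      rw [Finset.card_erase_of_mem (by grind), Finset.card_erase_of_mem (by grind),
        Finset.card_erase_of_mem ha]; omega)
  have hmem : ∀ t, t = x ∨ t = y → t ∈ G.nbrs v ∧ t ≠ a ∧ t ≠ b ∧ t ≠ c := fun t ht => by
    have : t ∈ (((G.nbrs v).erase a).erase b).erase c := by rw [hE]; simpa using ht
    simp only [Finset.mem_erase] at this
    exact ⟨this.2.2.2, this.2.2.1, this.2.1, this.1⟩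
  have hx := hmem x (by simp)
  have hy := hmem y (by simp)
  refine ⟨x, y, a, b, c, ?_, ?_, ?_, ?_, hnab, hnac, hnbc⟩
  · ext t
    have : t ≠ c ∧ t ≠ b ∧ t ≠ a ∧ t ∈ G.nbrs v ↔ t = x ∨ t = y := by
      rw [← Finset.mem_erase, ← Finset.mem_erase, ← Finset.mem_erase, hE]
      simp
    simp only [Finset.mem_insert, Finset.mem_singleton]
    constructor
    · tauto
    · rintro (rfl | rfl | rfl | rfl | rfl)
      exacts [hx.1, hy.1, ha, hb, hc]
  · simp; grind
  · exact key a ha b hb x hx.1 y hy.1 hab hx.2.1.symm hy.2.1.symm hx.2.2.1.symm hy.2.2.1.symm hxy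
      hnab
  · have h1 : ∀ t, t = x ∨ t = y → G.Adj t a ∧ G.Adj t b ∧ G.Adj t c := by
      intro t ht
      obtain ⟨h0, h1, h2, h3⟩ := hmem t ht
      exact ⟨key b hb c hc t h0 a ha hcb.symm h2.symm hab.symm h3.symm hca h1 hnbc,
        key a ha c hc t h0 b hb hca.symm h1.symm hab h3.symm hcb h2 hnac,
        key a ha b hb t h0 c hc hab h1.symm hca.symm h2.symm hcb.symm h3 hnab⟩
    have hx1 := h1 x (.inl rfl)
    have hy1 := h1 y (.inr rfl)
    simp only [List.mem_cons, List.not_mem_nil, or_false]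
    rintro t (rfl | rfl | rfl)
    exacts [⟨hx1.1, hy1.1⟩, ⟨hx1.2.1, hy1.2.1⟩, ⟨hx1.2.2, hy1.2.2⟩]

/-- The neighbourhood of `v` induces an edge `xy` completely joined to an independent set
`{a, b, c}`. -/
structure JoinNbrs (G : SimpleGraph (Fin N)) (v x y a b c : Fin N) : Prop where
  nbrs_eq : G.nbrs v = {x, y, a, b, c}
  nodup : [x, y, a, b, c].Nodup
  adj : G.Adj x y
  adj_left : ∀ t ∈ [a, b, c], G.Adj x t ∧ G.Adj y t
  not_adj₁ : ¬ G.Adj a b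
  not_adj₂ : ¬ G.Adj a c
  not_adj₃ : ¬ G.Adj b c

namespace JoinNbrs

variable {a b c p q : Fin N}

theorem swap (h : G.JoinNbrs v x y a b c) : G.JoinNbrs v y x a b c where
  nbrs_eq := by rw [h.nbrs_eq, Finset.insert_comm]
  nodup := (List.Perm.swap _ _ _).nodup h.nodup
  adj := h.adj.symm
  adj_left t ht := (h.adj_left t ht).symm
  not_adj₁ := h.not_adj₁
  not_adj₂ := h.not_adj₂
  not_adj₃ := h.not_adj₃

theorem adj_iff (h : G.JoinNbrs v x y a b c) (t : Fin N) :
    G.Adj v t ↔ t = x ∨ t = y ∨ t = a ∨ t = b ∨ t = c := by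
  rw [← mem_nbrs, h.nbrs_eq]
  simp

theorem adj_center (h : G.JoinNbrs v x y a b c) :
    G.Adj v x ∧ G.Adj v y ∧ G.Adj v a ∧ G.Adj v b ∧ G.Adj v c := by
  simp [h.adj_iff]

theorem containsK6C5_of_forall_adj (h : G.JoinNbrs v x y a b c) (hvp : v ≠ p)
    (hp : ∀ t ∈ G.nbrs v, G.Adj p t) : ContainsK6C5 G := by
  obtain ⟨hvx, hvy, hva, hvb, hvc⟩ := h.adj_center
  have hp' : ∀ t, G.Adj v t → G.Adj p t := fun t ht => hp t (by simpa using ht)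
  have hpx := hp' x hvx
  have hpy := hp' y hvy
  have hpa := hp' a hva
  have hpb := hp' b hvb
  clear hp hp'
  obtain ⟨-, hn, hxy, hl, -, -, -⟩ := h
  simp at hn hl
  apply containsK6C5_of_wheel (h := x) (a := a) (b := v) (c := b) (d := p) (e := y) <;>
    grind [SimpleGraph.adj_comm, SimpleGraph.Adj.ne]

theorem twoNonedges_or_adj (h : G.JoinNbrs v x y a b c) (hpq : G.Adj p q) (hvp : ¬ G.Adj v p)
    (hvq : ¬ G.Adj v q) (hne : v ≠ p) (hne' : v ≠ q) (hqx : ¬ G.Adj q x) :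
    (∃ G' : SimpleGraph (Fin N), (∀ i, degCount G' i = degCount G i) ∧ G'.TwoNonedges v) ∨
      G.Adj p y ∧ G.Adj p a ∧ G.Adj p b ∧ G.Adj p c := by
  obtain ⟨hvx, hvy, hva, hvb, hvc⟩ := h.adj_center
  obtain ⟨-, hn, hxy, hl, hab, hac, hbc⟩ := h
  simp only [List.nodup_cons, List.mem_cons, List.not_mem_nil, not_or, not_false_eq_true,
    or_false, List.nodup_nil, and_true] at hn
  obtain ⟨⟨h1, h2, h3, h4⟩, ⟨h5, h6, h7⟩, ⟨h8, h9⟩, h10⟩ := hn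
  rw [or_iff_not_imp_left]
  intro hno
  have key : ∀ s z w, G.Adj v s → G.Adj v z → G.Adj v w → s ≠ x → z ≠ x → w ≠ x → s ≠ z →
      s ≠ w → z ≠ w → ¬ G.Adj z w → G.Adj p s := by
    intro s z w hs hz hw hsx hzx hwx hsz hsw hzw hnzw
    by_contra hps
    exact hno ⟨G.switch v x p q, degCount_switch hvx hpq hvp (fun h => hqx h.symm) hvq hne hne',
      twoNonedges_switch hvx hpq hvp hvq hne hne' hs hz hw hsx hzx hwx hsz hsw hzw hps hnzw⟩
  refine ⟨key y a b hvy hva hvb ?_ ?_ ?_ ?_ ?_ ?_ hab, key a b c hva hvb hvc ?_ ?_ ?_ ?_ ?_ ?_ hbc,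
    key b a c hvb hva hvc ?_ ?_ ?_ ?_ ?_ ?_ hac, key c a b hvc hva hvb ?_ ?_ ?_ ?_ ?_ ?_ hab⟩ <;>
    first | assumption | (apply Ne.symm; assumption)

theorem containsK6C5_or_twoNonedges_of_not_adj (h : G.JoinNbrs v x y a b c) (hpq : G.Adj p q)
    (hvp : ¬ G.Adj v p) (hvq : ¬ G.Adj v q) (hne : v ≠ p) (hne' : v ≠ q) (hqx : ¬ G.Adj q x) :
    ContainsK6C5 G ∨
      ∃ G' : SimpleGraph (Fin N), (∀ i, degCount G' i = degCount G i) ∧ G'.TwoNonedges v := by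
  obtain hG | ⟨hpy, hpa, hpb, hpc⟩ := h.twoNonedges_or_adj hpq hvp hvq hne hne' hqx
  · exact .inr hG
  by_cases hpx : G.Adj p x
  · refine .inl (h.containsK6C5_of_forall_adj hne ?_)
    rw [h.nbrs_eq]
    simp_all
  obtain hG | ⟨hqy, hqa, hqb, hqc⟩ := h.twoNonedges_or_adj hpq.symm hvq hvp hne' hne hpx
  · exact .inr hG
  left
  obtain ⟨hvx, hvy, hva, hvb, hvc⟩ := h.adj_center
  obtain ⟨-, hn, hxy, hl, hab, hac, hbc⟩ := h
  simp at hn hl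
  apply containsK6C5_of_wheel (h := y) (a := a) (b := v) (c := b) (d := p) (e := q) <;>
    grind [SimpleGraph.adj_comm, SimpleGraph.Adj.ne]

theorem containsK6C5_or_twoNonedges (h : G.JoinNbrs v x y a b c) (ha : 5 ≤ degCount G a)
    (hmin : ∀ u, G.Adj a u → degCount G v ≤ degCount G u) :
    ContainsK6C5 G ∨
      ∃ G' : SimpleGraph (Fin N), (∀ i, degCount G' i = degCount G i) ∧ G'.TwoNonedges v := by
  obtain ⟨p, hap, hp⟩ := exists_adj_notMem (G := G) (v := a) {v, x, y}
    (Finset.card_le_three.trans_lt (by omega))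
  have hvp : ¬ G.Adj v p := by
    rw [h.adj_iff]
    have := h.not_adj₁
    have := h.not_adj₂
    grind [SimpleGraph.Adj.ne]
  have hne : v ≠ p := by grind
  obtain hall | ⟨q, hpq, hvq, hne'⟩ := forall_adj_or_exists_adj (hmin p hap) hvp
  · exact .inl (h.containsK6C5_of_forall_adj hne hall)
  by_cases hqx : G.Adj q x
  swap
  · exact h.containsK6C5_or_twoNonedges_of_not_adj hpq hvp hvq hne hne' hqx
  by_cases hqy : G.Adj q y
  swap
  · exact h.swap.containsK6C5_or_twoNonedges_of_not_adj hpq hvp hvq hne hne' hqy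
  by_cases hpx : G.Adj p x
  swap
  · exact h.containsK6C5_or_twoNonedges_of_not_adj hpq.symm hvq hvp hne' hne hpx
  left
  obtain ⟨hvx, hvy, hva, hvb, hvc⟩ := h.adj_center
  obtain ⟨-, hn, hxy, hl, hab, hac, hbc⟩ := h
  simp at hn hl
  apply containsK6C5_of_wheel (h := x) (a := y) (b := q) (c := p) (d := a) (e := v) <;>
    grind [SimpleGraph.adj_comm, SimpleGraph.Adj.ne]

end JoinNbrs

theorem containsK6C5_or_exists_twoNonedges {S : Finset (Fin N)} (hS : 7 ≤ S.card)
    (hGS : ∀ a b, G.Adj a b → a ∈ S) (h5 : degCount G v = 5) (hmin : ∀ u ∈ S, 5 ≤ degCount G u) :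
    ContainsK6C5 G ∨
      ∃ G' : SimpleGraph (Fin N), (∀ i, degCount G' i = degCount G i) ∧ G'.TwoNonedges v := by
  by_cases htwo : G.TwoNonedges v
  · exact .inr ⟨G, fun _ => rfl, htwo⟩
  obtain ⟨c, hc, hclique⟩ | ⟨x, y, a, b, c, h1, h2, h3, h4, h6, h7, h8⟩ :=
    nbrs_structure_of_not_twoNonedges (by rw [card_nbrs, h5]) htwo
  swap
  · have h : G.JoinNbrs v x y a b c := ⟨h1, h2, h3, h4, h6, h7, h8⟩
    have hva : G.Adj v a := by simp [h.adj_iff]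
    exact h.containsK6C5_or_twoNonedges (hmin a (hGS a v hva.symm))
      fun u hu => by rw [h5]; exact hmin u (hGS u a hu.symm)
  set A := (G.nbrs v).erase c with hAdef
  have hA : A.card = 4 := by rw [hAdef, Finset.card_erase_of_mem hc, card_nbrs, h5]
  have hv : ∀ a ∈ A, G.Adj v a := fun a ha => by simpa using Finset.mem_of_mem_erase ha
  have hvc : G.Adj v c := by simpa using hc
  obtain ⟨p, hpS, hpv, hvp⟩ := exists_mem_not_adj (G := G) (v := v) (S := S) (by omega)
  obtain hp | ⟨q, hpq, hvq, hqv⟩ :=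
    forall_adj_or_exists_adj (G := G) (h5.trans_le (hmin p hpS)) hvp
  · exact .inl (containsK6C5_of_clique hA hclique hv
      (fun a ha => hp a (Finset.mem_of_mem_erase ha)) hpv.symm)
  obtain h | ⟨a, ha, b, hb, hab, hqa, hpb⟩ :=
    containsK6C5_or_exists_not_adj hA hclique hv hpq hpv.symm hqv
  · exact .inl h
  obtain ⟨d, e, hde, hE⟩ := Finset.card_eq_two.1 (show ((A.erase a).erase b).card = 2 by
    rw [Finset.card_erase_of_mem (by grind), Finset.card_erase_of_mem ha]; omega)
  have hmem : ∀ t, t = d ∨ t = e → t ∈ A ∧ t ≠ a ∧ t ≠ b := fun t ht => by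
    have : t ∈ (A.erase a).erase b := by rw [hE]; simpa using ht
    simp only [Finset.mem_erase] at this
    exact ⟨this.2.2, this.2.1, this.1⟩
  have hd := hmem d (by simp)
  have he := hmem e (by simp)
  have hne : ∀ t ∈ A, t ≠ c := fun t ht => Finset.ne_of_mem_erase ht
  have key : ∀ t ∈ A, t ≠ a → t ≠ b → ¬ G.Adj c t →
      ∃ G' : SimpleGraph (Fin N), (∀ i, degCount G' i = degCount G i) ∧ G'.TwoNonedges v :=
    fun t ht hta htb hct => ⟨G.switch v a p q, degCount_switch (hv a ha) hpq hvp
      (fun h => hqa h.symm) hvq hpv.symm hqv, twoNonedges_switch (hv a ha) hpq hvp hvq hpv.symm hqv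
      (hv b hb) hvc (hv t ht) hab.symm (hne a ha).symm hta (hne b hb) htb.symm (hne t ht).symm
      hpb hct⟩
  by_cases hcd : G.Adj c d
  swap
  · exact .inr (key d hd.1 hd.2.1 hd.2.2 hcd)
  by_cases hce : G.Adj c e
  swap
  · exact .inr (key e he.1 he.2.1 he.2.2 hce)
  left
  clear_value A
  apply containsK6C5_of_wheel (h := d) (a := c) (b := v) (c := a) (d := b) (e := e) <;>
    grind [SimpleGraph.adj_comm, SimpleGraph.Adj.ne]

/-- The edges of `K₆ − C₅`, as pairs of natural numbers. -/
def wheelEdges : List (ℕ × ℕ) :=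
  [(0, 1), (0, 2), (0, 3), (0, 4), (0, 5), (1, 3), (3, 5), (5, 2), (2, 4), (4, 1)]

/-- The graph on `Fin n` whose edges are those of `K₆ − C₅` together with a list of chords. -/
def wheelWith (n : ℕ) (L : List (ℕ × ℕ)) : SimpleGraph (Fin n) :=
  SimpleGraph.fromRel fun a b => (a.val, b.val) ∈ wheelEdges ++ L

/-- A computable form of the vertex degrees of `wheelWith n L`. -/
def wheelWithDegree (n : ℕ) (L : List (ℕ × ℕ)) (i : Fin n) : ℕ :=
  (Finset.univ.filter fun j : Fin n => i ≠ j ∧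
    ((i.val, j.val) ∈ wheelEdges ++ L ∨ (j.val, i.val) ∈ wheelEdges ++ L)).card

theorem degCount_wheelWith (n : ℕ) (L : List (ℕ × ℕ)) (i : Fin n) :
    degCount (wheelWith n L) i = wheelWithDegree n L i := by
  rw [wheelWithDegree, ← card_nbrs]
  congr 1
  ext j
  simp only [mem_nbrs, wheelWith, fromRel_adj, Finset.mem_filter, Finset.mem_univ, true_and]

theorem containsK6C5_wheelWith {n : ℕ} (hn : 6 ≤ n) (L : List (ℕ × ℕ)) :
    ContainsK6C5 (wheelWith n L) := by
  refine ⟨Fin.castLE hn, Fin.castLE_injective hn, fun a b hab => ?_⟩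
  have h : ∀ a b : Fin 6, K6C5.Adj a b →
      (a.val, b.val) ∈ wheelEdges ∨ (b.val, a.val) ∈ wheelEdges := by decide
  simp only [wheelWith, fromRel_adj, List.mem_append]
  refine ⟨fun he => hab.ne (Fin.castLE_injective hn he), ?_⟩
  exact (h a b hab).imp .inl .inl

theorem _root_.DegreeForcesK6C5.of_map_eq {n : ℕ} {S : Finset (Fin N)}
    (hGS : ∀ a b, G.Adj a b → a ∈ S) {K : SimpleGraph (Fin n)} (hK : ContainsK6C5 K)
    (h : S.val.map (degCount G) = Finset.univ.val.map (degCount K)) : DegreeForcesK6C5 G := by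
  have hfib : ∀ c, Nonempty ({i : Fin n // degCount K i = c} ≃
      {s : S // degCount G (s : Fin N) = c}) := fun c => by
    have h1 := congrArg (Multiset.count c) h
    rw [Multiset.count_map, Multiset.count_map, ← Finset.filter_val, ← Finset.filter_val,
      Finset.card_val, Finset.card_val] at h1
    refine ⟨Fintype.equivOfCardEq ?_⟩
    rw [Fintype.card_congr (Equiv.subtypeSubtypeEquivSubtypeInter (· ∈ S) (degCount G · = c)),
      Fintype.card_of_subtype (S.filter (c = degCount G ·)) (by simp [eq_comm]), h1,
      Fintype.card_of_subtype (Finset.univ.filter (c = degCount K ·)) (by simp [eq_comm])]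
  let e : Fin n ≃ S := Equiv.ofFiberEquiv fun c => (hfib c).some
  have he : ∀ i, degCount G (e i : Fin N) = degCount K i :=
    Equiv.ofFiberEquiv_map (g := fun s : S => degCount G (s : Fin N)) fun c => (hfib c).some
  let emb : Fin n ↪ Fin N := e.toEmbedding.trans (Function.Embedding.subtype _)
  refine ⟨K.map emb, fun i => ?_, ?_⟩
  · by_cases hi : i ∈ S
    · obtain ⟨j, hj⟩ := e.surjective ⟨i, hi⟩
      have hji : i = emb j := by simp [emb, hj]
      have hG : degCount G (emb j) = degCount K j := he j
      rw [hji, hG, ← card_nbrs, ← card_nbrs, ← Finset.card_map emb]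
      congr 1
      ext t
      simp [SimpleGraph.map_adj]
    · rw [degCount_eq_zero, degCount_eq_zero fun u hu => hi (hGS _ _ hu)]
      rintro u ⟨-, a, b, -, rfl, -⟩
      exact hi (e a).2
  · obtain ⟨f, hf, hfK⟩ := hK
    exact ⟨emb ∘ f, emb.injective.comp hf, fun a b hab =>
      (SimpleGraph.map_adj_apply).2 (hfK a b hab)⟩

theorem multiset_eq_replicate {m : Multiset ℕ} (h : ∀ x ∈ m, 4 ≤ x ∧ x ≤ 8) :
    m = Multiset.replicate (m.count 4) 4 + Multiset.replicate (m.count 5) 5 +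
      Multiset.replicate (m.count 6) 6 + Multiset.replicate (m.count 7) 7 +
      Multiset.replicate (m.count 8) 8 := by
  ext a
  simp only [Multiset.count_add, Multiset.count_replicate]
  by_cases ha : a ∈ m
  · obtain ⟨h1, h2⟩ := h a ha
    interval_cases a <;> simp
  · have := Multiset.count_eq_zero_of_notMem ha
    split_ifs <;> simp_all

/-- Edge lists on `Fin 7` that complete the wheel to the degree sequences with minimum degree at
least 4 that are not covered by reductions. -/
def chordsSeven : List (List (ℕ × ℕ)) :=
  [[(0, 6), (1, 2), (1, 5), (1, 6), (3, 6), (4, 6)],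
   [(0, 6), (1, 2), (1, 5), (2, 6), (3, 6), (4, 6)],
   [(1, 2), (1, 6), (2, 3), (3, 6), (4, 6), (5, 6)]]

/-- Edge lists on `Fin 8` that complete the wheel to the degree sequences with minimum degree at
least 4 that are not covered by reductions. -/
def chordsEight : List (List (ℕ × ℕ)) :=
  [[(0, 6), (0, 7), (1, 2), (1, 5), (1, 6), (1, 7), (3, 6), (4, 7), (6, 7)],
   [(0, 6), (0, 7), (1, 2), (1, 5), (1, 6), (2, 6), (3, 7), (4, 7), (6, 7)],
   [(0, 6), (0, 7), (1, 2), (1, 5), (2, 6), (3, 6), (3, 7), (4, 7), (6, 7)],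
   [(0, 6), (1, 2), (1, 5), (1, 6), (2, 6), (2, 7), (3, 7), (4, 7), (6, 7)],
   [(0, 6), (1, 2), (1, 5), (1, 6), (2, 7), (3, 6), (3, 7), (4, 7), (6, 7)],
   [(0, 6), (1, 2), (1, 5), (2, 7), (3, 6), (3, 7), (4, 6), (4, 7), (6, 7)],
   [(1, 2), (1, 5), (2, 6), (3, 6), (3, 7), (4, 6), (4, 7), (5, 7), (6, 7)],
   [(1, 2), (1, 6), (2, 7), (3, 6), (3, 7), (4, 6), (4, 7), (5, 6), (5, 7), (6, 7)]]

/-- Edge lists on `Fin 9` that complete the wheel to the degree sequences with minimum degree at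
least 4 that are not covered by reductions. -/
def chordsNine : List (List (ℕ × ℕ)) :=
  [[(0, 6), (0, 7), (0, 8), (1, 2), (1, 5), (1, 6), (1, 7), (1, 8), (3, 4), (6, 7),
     (6, 8), (7, 8)],
   [(0, 6), (0, 7), (0, 8), (1, 2), (1, 5), (1, 6), (1, 7), (2, 3), (4, 8), (6, 7),
     (6, 8), (7, 8)],
   [(0, 6), (0, 7), (0, 8), (1, 2), (1, 5), (1, 6), (2, 3), (2, 7), (4, 8), (6, 7),
     (6, 8), (7, 8)],
   [(0, 6), (0, 7), (0, 8), (1, 2), (1, 5), (1, 6), (2, 3), (3, 7), (4, 8), (6, 7),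
     (6, 8), (7, 8)],
   [(0, 6), (0, 7), (0, 8), (1, 2), (1, 5), (2, 3), (3, 6), (4, 7), (4, 8), (6, 7),
     (6, 8), (7, 8)],
   [(0, 6), (0, 7), (1, 2), (1, 5), (1, 6), (1, 7), (2, 3), (2, 8), (4, 8), (6, 7),
     (6, 8), (7, 8)],
   [(0, 6), (0, 7), (1, 2), (1, 5), (1, 6), (1, 7), (2, 3), (3, 8), (4, 8), (6, 7),
     (6, 8), (7, 8)],
   [(0, 6), (0, 7), (1, 2), (1, 5), (1, 6), (2, 3), (2, 7), (3, 8), (4, 8), (6, 7),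
     (6, 8), (7, 8)],
   [(0, 6), (0, 7), (1, 2), (1, 5), (1, 6), (2, 3), (3, 8), (4, 7), (4, 8), (6, 7),
     (6, 8), (7, 8)],
   [(0, 6), (0, 7), (1, 2), (1, 5), (2, 3), (3, 6), (4, 7), (4, 8), (5, 8), (6, 7),
     (6, 8), (7, 8)],
   [(0, 6), (1, 2), (1, 5), (1, 6), (2, 3), (2, 7), (3, 7), (3, 8), (4, 8), (6, 7),
     (6, 8), (7, 8)],
   [(0, 6), (1, 2), (1, 5), (1, 6), (2, 3), (2, 7), (3, 8), (4, 7), (4, 8), (6, 7),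
     (6, 8), (7, 8)],
   [(0, 6), (1, 2), (1, 5), (1, 6), (2, 3), (3, 7), (4, 7), (4, 8), (5, 8), (6, 7),
     (6, 8), (7, 8)],
   [(0, 6), (1, 2), (1, 5), (2, 6), (3, 6), (3, 7), (4, 7), (4, 8), (5, 8), (6, 7),
     (6, 8), (7, 8)],
   [(1, 2), (1, 6), (2, 6), (3, 6), (3, 7), (4, 7), (4, 8), (5, 7), (5, 8), (6, 7),
     (6, 8), (7, 8)],
   [(0, 6), (1, 2), (1, 6), (2, 6), (3, 7), (3, 8), (4, 7), (4, 8), (5, 7), (5, 8),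
     (6, 7), (6, 8), (7, 8)]]

/-- The multiset with prescribed multiplicities of the numbers 4 to 8. -/
def degreeMultiset (k₄ k₅ k₆ k₇ k₈ : ℕ) : Multiset ℕ :=
  .replicate k₄ 4 + .replicate k₅ 5 + .replicate k₆ 6 + .replicate k₇ 7 + .replicate k₈ 8

theorem chordsSeven_spec : ∀ k₆ < 3, ∀ k₅ < 5, k₅ + 2 * k₆ = 4 →
    ∃ L ∈ chordsSeven, degreeMultiset (7 - k₅ - k₆) k₅ k₆ 0 0 =
      Finset.univ.val.map (wheelWithDegree 7 L) := by
  decide +kernel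

theorem chordsEight_spec : ∀ k₇ < 3, ∀ k₆ < 4, ∀ k₅ < 7, k₅ + 2 * k₆ + 3 * k₇ = 6 →
    ∃ L ∈ chordsEight, degreeMultiset (8 - k₅ - k₆ - k₇) k₅ k₆ k₇ 0 =
      Finset.univ.val.map (wheelWithDegree 8 L) := by
  decide +kernel

theorem chordsEight_spec' :
    ∃ L ∈ chordsEight, degreeMultiset 0 8 0 0 0 =
      Finset.univ.val.map (wheelWithDegree 8 L) := by
  decide +kernel

set_option synthInstance.maxHeartbeats 200000 in
set_option synthInstance.maxSize 1000 in
theorem chordsNine_spec :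
    ∀ k₈ < 3, ∀ k₇ < 3, ∀ k₆ < 5, ∀ k₅ < 9, k₅ + 2 * k₆ + 3 * k₇ + 4 * k₈ = 8 →
    ∃ L ∈ chordsNine, degreeMultiset (9 - k₅ - k₆ - k₇ - k₈) k₅ k₆ k₇ k₈ =
      Finset.univ.val.map (wheelWithDegree 9 L) := by
  decide +kernel

theorem chordsNine_spec' :
    ∃ L ∈ chordsNine, degreeMultiset 0 8 1 0 0 =
      Finset.univ.val.map (wheelWithDegree 9 L) := by
  decide +kernel

/-- The degree sequences on at most 9 vertices that resist the vertex-removal reductions. -/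
theorem degreeForcesK6C5_of_card_le_nine {S : Finset (Fin N)} (hGS : ∀ a b, G.Adj a b → a ∈ S)
    {δ : ℕ} (hδ : 4 ≤ δ) (hmin : ∀ u ∈ S, δ ≤ degCount G u) (hv : v ∈ S) (hvδ : degCount G v = δ)
    (hS : 7 ≤ S.card) (hS' : S.card ≤ 9) (heven : Even (∑ i ∈ S, degCount G i))
    (hlow : 6 * S.card ≤ ∑ i ∈ S, degCount G i + 10)
    (hup : ∑ i ∈ S, degCount G i + 16 < 2 * δ + 6 * S.card) : DegreeForcesK6C5 G := by
  have hmax : ∀ u ∈ S, degCount G u < S.card := fun u hu => by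
    rw [← card_nbrs]
    refine Finset.card_lt_card (Finset.ssubset_iff_subset_ne.2 ⟨fun t ht => ?_, ?_⟩)
    · exact hGS t u (by simpa [adj_comm] using ht)
    · rintro h
      rw [← h] at hu
      simp at hu
  set m := S.val.map (degCount G) with hm
  have hmem : ∀ x ∈ m, δ ≤ x ∧ x < S.card := by
    intro x hx
    obtain ⟨u, hu, rfl⟩ := Multiset.mem_map.1 hx
    exact ⟨hmin u hu, hmax u hu⟩
  have hcount : ∀ x, (x < δ ∨ S.card ≤ x) → m.count x = 0 := fun x hx =>
    Multiset.count_eq_zero_of_notMem fun h => by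
      have := hmem x h
      omega
  have hδm : 0 < m.count δ := Multiset.count_pos.2 (Multiset.mem_map.2 ⟨v, hv, hvδ⟩)
  have hm' := multiset_eq_replicate (m := m) fun x hx => by
    have := hmem x hx
    omega
  have hsum : m.sum = ∑ i ∈ S, degCount G i := rfl
  have hcard : m.card = S.card := Multiset.card_map _ _
  have hsum' := congrArg Multiset.sum hm'
  have hcard' := congrArg Multiset.card hm'
  simp only [Multiset.sum_add, Multiset.sum_replicate, Multiset.card_add, smul_eq_mul,
    Multiset.card_replicate] at hsum' hcard'
  rw [← hsum] at heven hlow hup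
  rw [hsum'] at heven hlow hup
  rw [hcard] at hcard'
  have conclude : ∀ n, 6 ≤ n → ∀ L : List (ℕ × ℕ),
      m = Finset.univ.val.map (wheelWithDegree n L) → DegreeForcesK6C5 G := fun n hn L h =>
    .of_map_eq hGS (containsK6C5_wheelWith hn L)
      (h.trans (Multiset.map_congr rfl fun i _ => (degCount_wheelWith n L i).symm))
  have h4 := hcount 4
  have h5 := hcount 5
  have h6 := hcount 6
  have h7 := hcount 7
  have h8 := hcount 8
  obtain ⟨r, hr⟩ := heven
  change m = degreeMultiset _ _ _ _ _ at hm'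
  generalize m.count 4 = k₄ at *
  generalize hk₅ : m.count 5 = k₅ at *
  generalize m.count 6 = k₆ at *
  generalize m.count 7 = k₇ at *
  generalize m.count 8 = k₈ at *
  have hδn : δ < S.card := hvδ ▸ hmax v hv
  generalize S.card = n at *
  have hδ' : δ = 4 ∨ δ = 5 := by
    by_contra hδ'
    have h4' := h4 (by omega)
    have h5' := h5 (by omega)
    obtain hδ | hδ : δ = 6 ∨ 7 ≤ δ := by omega
    · omega
    · have h6' := h6 (by omega)
      obtain hδ | hδ : δ = 7 ∨ 8 = δ := by omega
      · omega
      · have h7' := h7 (by omega)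
        omega
  obtain rfl | rfl | rfl : n = 7 ∨ n = 8 ∨ n = 9 := by omega
  · obtain rfl : k₈ = 0 := by omega
    obtain rfl : k₇ = 0 := by omega
    obtain ⟨L, -, hL⟩ := chordsSeven_spec k₆ (by omega) k₅ (by omega) (by omega)
    exact conclude 7 (by omega) L (by rw [← hL, hm']; congr 1; omega)
  · obtain rfl : k₈ = 0 := by omega
    obtain rfl | rfl := hδ'
    · obtain ⟨L, -, hL⟩ := chordsEight_spec k₇ (by omega) k₆ (by omega) k₅ (by omega) (by omega)
      exact conclude 8 (by omega) L (by rw [← hL, hm']; congr 1; omega)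
    · obtain ⟨L, -, hL⟩ := chordsEight_spec'
      refine conclude 8 (by omega) L (by rw [← hL, hm']; congr 1 <;> omega)
  · obtain rfl | rfl := hδ'
    · obtain ⟨L, -, hL⟩ := chordsNine_spec k₈ (by omega) k₇ (by omega) k₆ (by omega) k₅ (by omega)
        (by omega)
      exact conclude 9 (by omega) L (by rw [← hL, hm']; congr 1; omega)
    · obtain ⟨L, -, hL⟩ := chordsNine_spec'
      refine conclude 9 (by omega) L (by rw [← hL, hm']; congr 1 <;> omega)

/-- Placements of `K₆ − C₅` in a 6-vertex complete graph. -/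
def placements : List (Fin 6 → Fin 6) :=
  [![0, 1, 2, 3, 4, 5], ![0, 1, 3, 5, 2, 4], ![1, 0, 2, 3, 5, 4], ![1, 0, 3, 2, 4, 5],
   ![2, 0, 1, 4, 3, 5], ![3, 0, 1, 5, 2, 4], ![4, 0, 2, 1, 5, 3], ![2, 0, 4, 3, 1, 5],
   ![0, 1, 3, 2, 5, 4], ![3, 0, 4, 1, 2, 5], ![5, 0, 1, 3, 4, 2], ![1, 0, 2, 5, 4, 3],
   ![5, 0, 3, 1, 2, 4], ![2, 0, 1, 4, 5, 3], ![3, 0, 2, 4, 1, 5], ![4, 0, 1, 2, 3, 5]]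

theorem exists_placement : ∀ a b c d : Fin 6, ∃ σ ∈ placements, (∀ i j, σ i = σ j → i = j) ∧
    ∀ i j, K6C5.Adj i j → ¬ ((σ i = a ∧ σ j = b) ∨ (σ i = c ∧ σ j = d)) := by
  decide +kernel

theorem containsK6C5_of_nonedges {S : Finset (Fin N)} (hS : S.card = 6) {a b c d : Fin N}
    (ha : a ∈ S) (hb : b ∈ S) (hc : c ∈ S) (hd : d ∈ S)
    (h : ∀ x ∈ S, ∀ y ∈ S, x ≠ y → ¬ G.Adj x y →
      (x = a ∧ y = b) ∨ (y = a ∧ x = b) ∨ (x = c ∧ y = d) ∨ (y = c ∧ x = d)) :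
    ContainsK6C5 G := by
  let e := S.equivFinOfCardEq hS
  obtain ⟨σ, -, hσ, hσK⟩ := exists_placement (e ⟨a, ha⟩) (e ⟨b, hb⟩) (e ⟨c, hc⟩) (e ⟨d, hd⟩)
  have key : ∀ i (t : Fin N) (ht : t ∈ S), (e.symm (σ i) : Fin N) = t → σ i = e ⟨t, ht⟩ :=
    fun i t ht hit => by simp [← hit]
  refine ⟨fun i => e.symm (σ i), fun i j hij => hσ i j ?_, fun i j hij => ?_⟩
  · exact e.symm.injective (Subtype.ext hij)
  · by_contra hadj
    have hne : (e.symm (σ i) : Fin N) ≠ e.symm (σ j) := fun he =>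
      hij.ne (hσ i j (e.symm.injective (Subtype.ext he)))
    have h1 := hσK i j hij
    have h2 := hσK j i hij.symm
    rcases h _ (e.symm (σ i)).2 _ (e.symm (σ j)).2 hne hadj with
      ⟨h3, h4⟩ | ⟨h3, h4⟩ | ⟨h3, h4⟩ | ⟨h3, h4⟩
    · exact h1 (.inl ⟨key _ _ _ h3, key _ _ _ h4⟩)
    · exact h2 (.inl ⟨key _ _ _ h3, key _ _ _ h4⟩)
    · exact h1 (.inr ⟨key _ _ _ h3, key _ _ _ h4⟩)
    · exact h2 (.inr ⟨key _ _ _ h3, key _ _ _ h4⟩)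

theorem containsK6C5_of_card_eq_six {S : Finset (Fin N)} (hGS : ∀ a b, G.Adj a b → a ∈ S)
    (hS : S.card = 6) (hsum : 26 ≤ ∑ i ∈ S, degCount G i) : ContainsK6C5 G := by
  set M := S.sigma fun x => S.erase x \ G.nbrs x with hM
  have hMmem : ∀ x y, (⟨x, y⟩ : (_ : Fin N) × Fin N) ∈ M ↔ x ∈ S ∧ y ∈ S ∧ x ≠ y ∧ ¬ G.Adj x y := by
    intro x y
    simp [hM, mem_nbrs]
    tauto
  have hMcard : M.card ≤ 4 := by
    have h1 : M.card + ∑ i ∈ S, degCount G i = 30 := by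
      rw [hM, Finset.card_sigma, ← Finset.sum_add_distrib, Finset.sum_congr rfl (g := fun _ => 5)]
      · simp [hS]
      · intro x hx
        rw [← card_nbrs, Finset.card_sdiff_add_card_eq_card, Finset.card_erase_of_mem hx, hS]
        intro t ht
        rw [mem_nbrs] at ht
        exact Finset.mem_erase.2 ⟨ht.ne', hGS _ _ ht.symm⟩
    omega
  by_cases hcl : ∀ x ∈ S, ∀ y ∈ S, x ≠ y → G.Adj x y
  · obtain ⟨a, ha⟩ : S.Nonempty := Finset.card_pos.1 (by omega)
    exact containsK6C5_of_nonedges hS ha ha ha ha fun x hx y hy hxy hadj =>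
      (hadj (hcl x hx y hy hxy)).elim
  push Not at hcl
  obtain ⟨a, ha, b, hb, hab, habG⟩ := hcl
  by_cases hcl' : ∀ x ∈ S, ∀ y ∈ S, x ≠ y → ¬ G.Adj x y → (x = a ∧ y = b) ∨ (y = a ∧ x = b)
  · exact containsK6C5_of_nonedges hS ha hb ha hb fun x hx y hy hxy hadj => by
      have := hcl' x hx y hy hxy hadj
      tauto
  push Not at hcl'
  obtain ⟨c, hc, d, hd, hcd, hcdG, h1, h2⟩ := hcl'
  refine containsK6C5_of_nonedges hS ha hb hc hd fun x hx y hy hxy hadj => ?_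
  by_contra hcon
  have hsub : ({⟨a, b⟩, ⟨b, a⟩, ⟨c, d⟩, ⟨d, c⟩, ⟨x, y⟩} : Finset ((_ : Fin N) × Fin N)) ⊆ M := by
    simp only [Finset.insert_subset_iff, Finset.singleton_subset_iff, hMmem]
    exact ⟨⟨ha, hb, hab, habG⟩, ⟨hb, ha, hab.symm, fun h => habG h.symm⟩, ⟨hc, hd, hcd, hcdG⟩,
      ⟨hd, hc, hcd.symm, fun h => hcdG h.symm⟩, hx, hy, hxy, hadj⟩
  have h5 := (Finset.card_le_card hsub).trans hMcard
  rw [Finset.card_insert_of_notMem, Finset.card_insert_of_notMem, Finset.card_insert_of_notMem,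
    Finset.card_insert_of_notMem, Finset.card_singleton] at h5
  · omega
  all_goals
    simp only [Finset.mem_insert, Finset.mem_singleton, Sigma.mk.injEq, heq_eq_eq]
    grind

/-- On every set of `n` vertices, degree sum at least `6n - 10` forces `K₆ − C₅`. -/
def SumForcesK6C5 (N n : ℕ) : Prop :=
  ∀ S : Finset (Fin N), S.card = n → ∀ G : SimpleGraph (Fin N), (∀ a b, G.Adj a b → a ∈ S) →
    6 * n ≤ ∑ i ∈ S, degCount G i + 10 → DegreeForcesK6C5 G

theorem ite_mem_insert {r u : Fin N} {U : Finset (Fin N)} (hr : r ∉ U) :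
    (if u ∈ insert r U then 1 else 0) = (if u = r then 1 else 0) + if u ∈ U then 1 else 0 := by
  by_cases hur : u = r
  · subst hur
    simp [hr]
  · simp [hur]

theorem nbrs_subset_erase {S : Finset (Fin N)} (hGS : ∀ a b, G.Adj a b → a ∈ S) :
    G.nbrs v ⊆ S.erase v := fun t ht => by
  rw [mem_nbrs] at ht
  exact Finset.mem_erase.2 ⟨ht.ne', hGS _ _ ht.symm⟩

theorem sum_degCount_deleteIncidenceSet {S : Finset (Fin N)} (hGS : ∀ a b, G.Adj a b → a ∈ S)
    (hv : v ∈ S) : ∑ i ∈ S.erase v, degCount (G.deleteIncidenceSet v) i + 2 * degCount G v =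
      ∑ i ∈ S, degCount G i := by
  have h1 : ∑ i ∈ S.erase v, (degCount (G.deleteIncidenceSet v) i +
      if i ∈ G.nbrs v then 1 else 0) = ∑ i ∈ S.erase v, degCount G i :=
    Finset.sum_congr rfl fun i hi => degCount_deleteIncidenceSet (Finset.ne_of_mem_erase hi)
  rw [Finset.sum_add_distrib, Finset.sum_ite_mem, Finset.sum_const,
    Finset.inter_eq_right.2 (nbrs_subset_erase hGS), card_nbrs, smul_eq_mul, mul_one] at h1
  have h2 := Finset.sum_erase_add S (degCount G) hv
  omega

theorem sum_degCount_sup_edge {S : Finset (Fin N)} (hx : x ∈ S) (hy : y ∈ S) (hxy : x ≠ y)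
    (h : ¬ G.Adj x y) :
    ∑ i ∈ S, degCount (G ⊔ edge x y) i = ∑ i ∈ S, degCount G i + 2 := by
  simp [degCount_sup_edge hxy h, Finset.sum_add_distrib, hx, hy]

theorem deleteIncidenceSet_mem {S : Finset (Fin N)} (hGS : ∀ a b, G.Adj a b → a ∈ S) (a b : Fin N)
    (h : (G.deleteIncidenceSet v).Adj a b) : a ∈ S.erase v := by
  rw [deleteIncidenceSet_adj] at h
  exact Finset.mem_erase.2 ⟨h.2.1, hGS _ _ h.1⟩

theorem sup_edge_mem {S : Finset (Fin N)} (hGS : ∀ a b, G.Adj a b → a ∈ S) (hx : x ∈ S)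
    (hy : y ∈ S) (a b : Fin N) (h : (G ⊔ edge x y).Adj a b) : a ∈ S := by
  rw [sup_adj, edge_adj] at h
  rcases h with h | ⟨⟨rfl, -⟩ | ⟨rfl, -⟩, -⟩
  exacts [hGS _ _ h, hx, hy]

/-- Restoring a removed vertex. -/
theorem _root_.DegreeForcesK6C5.of_spokes (hH : ContainsK6C5 H) (hv : degCount H v = 0)
    {T : Finset (Fin N)} (hvT : v ∉ T) (hT : T.card = degCount G v)
    (hdeg : ∀ u, u ≠ v → degCount H u + (if u ∈ T then 1 else 0) = degCount G u) :
    DegreeForcesK6C5 G := by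
  refine ⟨H ⊔ spokes v T, fun u => ?_, hH.mono fun a b hab => Or.inl hab⟩
  rw [degCount_sup_spokes hvT (not_adj_of_degCount_eq_zero hv)]
  split_ifs with huv huT
  · rw [huv, hv, hT, zero_add]
  · simpa [huT] using hdeg u huv
  · simpa [huT] using hdeg u huv

theorem degreeForcesK6C5_of_delete {n : ℕ} {S : Finset (Fin N)} (ih : SumForcesK6C5 N n)
    (hS : S.card = n + 1) (hGS : ∀ a b, G.Adj a b → a ∈ S) (hv : v ∈ S)
    (hsum : 2 * degCount G v + 6 * n ≤ ∑ i ∈ S, degCount G i + 10) : DegreeForcesK6C5 G := by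
  have h1 := sum_degCount_deleteIncidenceSet hGS hv
  obtain ⟨H, hH, hK⟩ := ih (S.erase v) (by rw [Finset.card_erase_of_mem hv]; omega)
    (G.deleteIncidenceSet v) (deleteIncidenceSet_mem hGS) (by omega)
  refine .of_spokes (T := G.nbrs v) hK ?_ (by simp) (card_nbrs G v) fun u hu => ?_
  · rw [hH]
    exact degCount_eq_zero fun u hu => by simp [deleteIncidenceSet_adj] at hu
  · rw [hH, degCount_deleteIncidenceSet hu]

theorem degreeForcesK6C5_of_nonedge {n : ℕ} {S : Finset (Fin N)} (ih : SumForcesK6C5 N n)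
    (hn : 9 ≤ n) (hS : S.card = n + 1) (hGS : ∀ a b, G.Adj a b → a ∈ S) (hv : v ∈ S)
    (h4 : degCount G v = 4) (hmin : ∀ u ∈ S, 4 ≤ degCount G u)
    (hsum : 6 * (n + 1) ≤ ∑ i ∈ S, degCount G i + 10)
    (hx : G.Adj v x) (hy : G.Adj v y) (hxy : x ≠ y) (hxyG : ¬ G.Adj x y) :
    DegreeForcesK6C5 G := by
  set G₀ := G.deleteIncidenceSet v with hG₀
  have hxyG₀ : ¬ G₀.Adj x y := fun h => hxyG (deleteIncidenceSet_adj.1 h).1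
  have hxS : x ∈ S.erase v := Finset.mem_erase.2 ⟨hx.ne', hGS _ _ hx.symm⟩
  have hyS : y ∈ S.erase v := Finset.mem_erase.2 ⟨hy.ne', hGS _ _ hy.symm⟩
  have h1 := sum_degCount_deleteIncidenceSet hGS hv
  rw [← hG₀] at h1
  have h2 := sum_degCount_sup_edge hxS hyS hxy hxyG₀
  obtain ⟨H, hH, f, hf, hfH⟩ := ih (S.erase v) (by rw [Finset.card_erase_of_mem hv]; omega)
    (G₀ ⊔ edge x y) (sup_edge_mem (deleteIncidenceSet_mem hGS) hxS hyS) (by omega)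
  have hHv : degCount H v = 0 := by
    rw [hH]
    exact degCount_eq_zero fun u hu => Finset.notMem_erase v S
      (sup_edge_mem (deleteIncidenceSet_mem hGS) hxS hyS _ _ hu)
  have hv0 : ∀ u, ¬ H.Adj v u := not_adj_of_degCount_eq_zero hHv
  set U := (G.nbrs v).erase x |>.erase y with hU
  have hyU : y ∉ U := Finset.notMem_erase _ _
  have hxU : x ∉ insert y U := by simp [hU, hxy]
  have hins : G.nbrs v = insert x (insert y U) := by
    rw [hU, Finset.insert_erase, Finset.insert_erase] <;> simp [mem_nbrs, hx, hy, hxy.symm]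
  have hUcard : U.card = 2 := by
    have := card_nbrs G v
    rw [hins, Finset.card_insert_of_notMem hxU, Finset.card_insert_of_notMem hyU] at this
    omega
  have hdeg : ∀ u, u ≠ v → degCount H u + (if u ∈ U then 1 else 0) = degCount G u := fun u hu => by
    have h3 := degCount_deleteIncidenceSet (G := G) hu
    rw [← hG₀, hins, ite_mem_insert hxU, ite_mem_insert hyU] at h3
    rw [hH, degCount_sup_edge hxy hxyG₀]
    omega
  obtain ⟨r, hrS, hr⟩ := Finset.exists_mem_notMem_of_card_lt_card
    (s := insert v (Finset.univ.image f ∪ U)) (t := S) (by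
      have h3 := Finset.card_insert_le v (Finset.univ.image f ∪ U)
      have h4 := Finset.card_union_le (Finset.univ.image f) U
      have h5 : (Finset.univ.image f).card ≤ 6 := Finset.card_image_le
      omega)
  simp only [Finset.mem_insert, Finset.mem_union, Finset.mem_image, Finset.mem_univ, true_and,
    not_or, not_exists] at hr
  obtain ⟨hrv, hrf, hrU⟩ := hr
  obtain ⟨s, hrs, hsU⟩ := exists_adj_notMem (G := H) (v := r) U (by
    have h3 := hdeg r hrv
    have h4 := hmin r hrS
    simp only [hrU, if_false] at h3
    omega)
  have hsv : s ≠ v := fun h => hv0 r (h ▸ hrs.symm)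
  have hrU' : r ∉ insert s U := by simp [hrs.ne, hrU]
  have hvU : v ∉ U := by simp [hU, mem_nbrs]
  refine .of_spokes (v := v) (H := H \ edge r s) (T := insert r (insert s U))
    ?_ ?_ ?_ ?_ fun u hu => ?_
  · refine ⟨f, hf, fun a b hab => ⟨hfH a b hab, fun h => ?_⟩⟩
    rw [edge_adj] at h
    rcases h.1 with h | h
    exacts [hrf a h.1, hrf b h.2]
  · exact degCount_eq_zero fun u hu => hv0 u hu.1
  · simp [Ne.symm hrv, hsv.symm, hvU]
  · rw [Finset.card_insert_of_notMem hrU', Finset.card_insert_of_notMem hsU]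
    omega
  · have h3 := degCount_sdiff_edge (v := u) hrs
    have h4 := hdeg u hu
    rw [ite_mem_insert hrU', ite_mem_insert hsU]
    omega

theorem degreeForcesK6C5_of_twoNonedges {n : ℕ} {S : Finset (Fin N)} (ih : SumForcesK6C5 N n)
    (hn : 9 ≤ n) (hS : S.card = n + 1) (hGS : ∀ a b, G.Adj a b → a ∈ S) (hv : v ∈ S)
    (h5 : degCount G v = 5) (hmin : ∀ u ∈ S, 5 ≤ degCount G u)
    (hsum : 6 * (n + 1) ≤ ∑ i ∈ S, degCount G i + 10) (hG : G.TwoNonedges v) :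
    DegreeForcesK6C5 G := by
  obtain ⟨x, y, z, w, ⟨hx, hy, hz, hw⟩, ⟨hxy, hxz, hxw, hyz, hyw, hzw⟩, hxyG, hzwG⟩ := hG
  set G₀ := G.deleteIncidenceSet v with hG₀
  have hxyG₀ : ¬ G₀.Adj x y := fun h => hxyG (deleteIncidenceSet_adj.1 h).1
  have hzwG₀ : ¬ (G₀ ⊔ edge x y).Adj z w := by
    rw [sup_adj, edge_adj]
    rintro (h | ⟨⟨h, -⟩ | ⟨h, -⟩, -⟩)
    exacts [hzwG (deleteIncidenceSet_adj.1 h).1, hxz h.symm, hyz h.symm]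
  have hsub := nbrs_subset_erase (v := v) hGS
  have h1 := sum_degCount_deleteIncidenceSet hGS hv
  rw [← hG₀] at h1
  have h2 := sum_degCount_sup_edge (hsub hx) (hsub hy) hxy hxyG₀
  have h3 := sum_degCount_sup_edge (hsub hz) (hsub hw) hzw hzwG₀
  have hmem := sup_edge_mem (sup_edge_mem (deleteIncidenceSet_mem hGS) (hsub hx) (hsub hy))
    (hsub hz) (hsub hw)
  obtain ⟨H, hH, f, hf, hfH⟩ := ih (S.erase v) (by rw [Finset.card_erase_of_mem hv]; omega)
    (G₀ ⊔ edge x y ⊔ edge z w) hmem (by omega)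
  have hHv : degCount H v = 0 := by
    rw [hH]
    exact degCount_eq_zero fun u hu => Finset.notMem_erase v S (hmem _ _ hu)
  have hv0 : ∀ u, ¬ H.Adj v u := not_adj_of_degCount_eq_zero hHv
  set U := G.nbrs v \ {x, y, z, w} with hU
  have hwU : w ∉ U := by simp [hU]
  have hzU : z ∉ insert w U := by simp [hU, hzw]
  have hyU : y ∉ insert z (insert w U) := by simp [hU, hyz, hyw]
  have hxU : x ∉ insert y (insert z (insert w U)) := by simp [hU, hxy, hxz, hxw]
  have hins : G.nbrs v = insert x (insert y (insert z (insert w U))) := by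
    have hsub : {x, y, z, w} ⊆ G.nbrs v := by simp [Finset.insert_subset_iff, *]
    refine (Finset.union_sdiff_of_subset hsub).symm.trans ?_
    simp only [Finset.insert_union, Finset.singleton_union, hU]
  have hUcard : U.card = 1 := by
    have := card_nbrs G v
    rw [hins, Finset.card_insert_of_notMem hxU, Finset.card_insert_of_notMem hyU,
      Finset.card_insert_of_notMem hzU, Finset.card_insert_of_notMem hwU] at this
    omega
  have hdeg : ∀ u, u ≠ v → degCount H u + (if u ∈ U then 1 else 0) = degCount G u := fun u hu => by
    have h3 := degCount_deleteIncidenceSet (G := G) hu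
    rw [← hG₀, hins, ite_mem_insert hxU, ite_mem_insert hyU, ite_mem_insert hzU,
      ite_mem_insert hwU] at h3
    rw [hH, degCount_sup_edge hzw hzwG₀, degCount_sup_edge hxy hxyG₀]
    omega
  have hbig : ((insert v (Finset.univ.image f ∪ U)).card) ≤ 8 := by
    have h3 := Finset.card_insert_le v (Finset.univ.image f ∪ U)
    have h4 := Finset.card_union_le (Finset.univ.image f) U
    have h5 : (Finset.univ.image f).card ≤ 6 := Finset.card_image_le
    omega
  obtain ⟨r, hrS, hr⟩ := Finset.exists_mem_notMem_of_card_lt_card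
    (s := insert v (Finset.univ.image f ∪ U)) (t := S) (by omega)
  obtain ⟨q, hqS, hq⟩ := Finset.exists_mem_notMem_of_card_lt_card
    (s := insert r (insert v (Finset.univ.image f ∪ U))) (t := S) (by
      have := Finset.card_insert_le r (insert v (Finset.univ.image f ∪ U))
      omega)
  simp only [Finset.mem_insert, Finset.mem_union, Finset.mem_image, Finset.mem_univ, true_and,
    not_or, not_exists] at hr hq
  obtain ⟨hrv, hrf, hrU⟩ := hr
  obtain ⟨hqr, hqv, hqf, hqU⟩ := hq
  have hdegH : ∀ u ∈ S, u ≠ v → u ∉ U → 5 ≤ degCount H u := fun u huS huv huU => by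
    have h3 := hdeg u huv
    have h4 := hmin u huS
    simp only [huU, if_false] at h3
    omega
  obtain ⟨s, hrs, hs⟩ := exists_adj_notMem (G := H) (v := r) (insert q U) (by
    have h3 := hdegH r hrS hrv hrU
    have h4 := Finset.card_insert_le q U
    omega)
  obtain ⟨t, hqt, ht⟩ := exists_adj_notMem (G := H) (v := q) (insert r (insert s U)) (by
    have h3 := hdegH q hqS hqv hqU
    have h4 := Finset.card_insert_le s U
    have h5 := Finset.card_insert_le r (insert s U)
    omega)
  simp only [Finset.mem_insert, not_or] at hs ht
  obtain ⟨hsq, hsU⟩ := hs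
  obtain ⟨htr, hts, htU⟩ := ht
  have hsv : s ≠ v := fun h => hv0 r (h ▸ hrs.symm)
  have htv : t ≠ v := fun h => hv0 q (h ▸ hqt.symm)
  have hvU : v ∉ U := by simp [hU, mem_nbrs]
  have hqU' : q ∉ insert t U := by simp [hqt.ne, hqU]
  have hsU' : s ∉ insert q (insert t U) := by simp [hsq, Ne.symm hts, hsU]
  have hrU' : r ∉ insert s (insert q (insert t U)) := by
    simp [hrs.ne, Ne.symm hqr, Ne.symm htr, hrU]
  have hqt' : (H \ edge r s).Adj q t := ⟨hqt, fun h => by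
    rw [edge_adj] at h
    rcases h.1 with h | h
    exacts [hqr h.1, hsq h.1.symm]⟩
  refine .of_spokes (v := v) (H := (H \ edge r s) \ edge q t)
    (T := insert r (insert s (insert q (insert t U)))) ?_ ?_ ?_ ?_ fun u hu => ?_
  · refine ⟨f, hf, fun a b hab => ⟨⟨hfH a b hab, fun h => ?_⟩, fun h => ?_⟩⟩
    · rw [edge_adj] at h
      rcases h.1 with h | h
      exacts [hrf a h.1, hrf b h.2]
    · rw [edge_adj] at h
      rcases h.1 with h | h
      exacts [hqf a h.1, hqf b h.2]
  · exact degCount_eq_zero fun u hu => hv0 u hu.1.1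
  · simp [Ne.symm hrv, hsv.symm, Ne.symm hqv, htv.symm, hvU]
  · rw [Finset.card_insert_of_notMem hrU', Finset.card_insert_of_notMem hsU',
      Finset.card_insert_of_notMem hqU', Finset.card_insert_of_notMem htU]
    omega
  · have h3 := degCount_sdiff_edge (v := u) hrs
    have h3' := degCount_sdiff_edge (v := u) hqt'
    have h4 := hdeg u hu
    rw [ite_mem_insert hrU', ite_mem_insert hsU', ite_mem_insert hqU', ite_mem_insert htU]
    omega

theorem _root_.ContainsK6C5.degreeForces (h : ContainsK6C5 G) : DegreeForcesK6C5 G :=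
  ⟨G, fun _ => rfl, h⟩

theorem mem_of_degCount_eq {S : Finset (Fin N)} (hGH : ∀ i, degCount H i = degCount G i)
    (hGS : ∀ a b, G.Adj a b → a ∈ S) (a b : Fin N) (hab : H.Adj a b) : a ∈ S := by
  by_contra ha
  have h : degCount H a = 0 := by
    rw [hGH]
    exact degCount_eq_zero fun u hu => ha (hGS _ _ hu)
  exact not_adj_of_degCount_eq_zero h b hab

theorem even_sum_degCount_of_mem {S : Finset (Fin N)} (hGS : ∀ a b, G.Adj a b → a ∈ S) :
    Even (∑ i ∈ S, degCount G i) := by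
  rw [Finset.sum_subset (Finset.subset_univ S) fun i _ hi =>
    degCount_eq_zero fun u hu => hi (hGS _ _ hu)]
  exact even_sum_degCount G

theorem sumForcesK6C5 {n : ℕ} (hn : 6 ≤ n) : SumForcesK6C5 N n := by
  induction n, hn using Nat.le_induction with
  | base =>
    exact fun S hS G hGS hsum => (containsK6C5_of_card_eq_six hGS hS (by omega)).degreeForces
  | succ n hn ih =>
    intro S hS G hGS hsum
    obtain ⟨v, hv, hmin⟩ := Finset.exists_min_image S (degCount G) (Finset.card_pos.1 (by omega))
    by_cases hup : 2 * degCount G v + 6 * n ≤ ∑ i ∈ S, degCount G i + 10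
    · exact degreeForcesK6C5_of_delete ih hS hGS hv hup
    have hmul : (n + 1) * degCount G v ≤ ∑ i ∈ S, degCount G i := by
      rw [← hS, ← smul_eq_mul]
      exact Finset.card_nsmul_le_sum _ _ _ hmin
    have heven := even_sum_degCount_of_mem hGS
    have h4 : 4 ≤ degCount G v := by
      obtain ⟨k, hk⟩ := heven
      omega
    by_cases hn' : n ≤ 8
    · exact degreeForcesK6C5_of_card_le_nine hGS h4 hmin hv rfl (by omega) (by omega) heven
        (by omega) (by omega)
    obtain h4 | h5 : degCount G v = 4 ∨ degCount G v = 5 := by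
      have : degCount G v < 6 := by
        by_contra h
        nlinarith
      omega
    · rw [h4] at hmin
      obtain h | ⟨G', hG', x, y, hx, hy, hxy, hxyG⟩ :=
        exists_not_adj_of_degCount_eq_four (S := S) (by omega) h4 hmin
      · exact h.degreeForces
      · have hGS' := mem_of_degCount_eq hG' hGS
        refine .of_eq hG' (degreeForcesK6C5_of_nonedge ih (by omega) hS hGS' hv (by rw [hG', h4])
          (by simpa only [hG'] using hmin) (by simpa only [hG'] using hsum) hx hy hxy hxyG)
    · rw [h5] at hmin
      obtain h | ⟨G', hG', htwo⟩ :=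
        containsK6C5_or_exists_twoNonedges (S := S) (by omega) hGS h5 hmin
      · exact h.degreeForces
      · have hGS' := mem_of_degCount_eq hG' hGS
        refine .of_eq hG' (degreeForcesK6C5_of_twoNonedges ih (by omega) hS hGS' hv
          (by rw [hG', h5]) (by simpa only [hG'] using hmin) (by simpa only [hG'] using hsum) htwo)

/-- The first `k` vertices are joined to everything, and there are no further edges. -/
def dominated (N k : ℕ) : SimpleGraph (Fin N) :=
  SimpleGraph.fromRel fun i _ => i.val < k

theorem card_filter_val_lt {k : ℕ} (hk : k ≤ N) :
    (Finset.univ.filter fun i : Fin N => i.val < k).card = k := by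
  rw [Fin.card_filter_val_lt, min_eq_right hk]

theorem degCount_dominated {k : ℕ} (hk : k ≤ N) (i : Fin N) :
    degCount (dominated N k) i = if i.val < k then N - 1 else k := by
  rw [← card_nbrs]
  split_ifs with hi
  · have : (dominated N k).nbrs i = Finset.univ.erase i := by
      ext j
      simp [dominated, hi, eq_comm]
    simp [this]
  · have : (dominated N k).nbrs i = Finset.univ.filter fun j : Fin N => j.val < k := by
      ext j
      simp only [mem_nbrs, dominated, fromRel_adj, Finset.mem_filter, Finset.mem_univ, true_and,
        hi, false_or, and_iff_right_iff_imp]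
      rintro hj rfl
      exact hi hj
    rw [this, card_filter_val_lt hk]

theorem not_adj_of_degCount_eq {k : ℕ} (hk : k ≤ N)
    (h : ∀ i, degCount G i = if i.val < k then N - 1 else k) (hx : k ≤ x.val) (hy : k ≤ y.val) :
    ¬ G.Adj x y := by
  have hfull : ∀ i j : Fin N, i.val < k → i ≠ j → G.Adj i j := fun i j hi hij => by
    have hsub : G.nbrs i ⊆ Finset.univ.erase i := fun t ht => by
      rw [mem_nbrs] at ht
      simpa using ht.ne'
    have heq := Finset.eq_of_subset_of_card_le hsub (by
      rw [card_nbrs, h, if_pos hi, Finset.card_erase_of_mem (Finset.mem_univ _), Finset.card_univ,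
        Fintype.card_fin])
    rw [← mem_nbrs, heq]
    simpa using hij.symm
  have hsub : (Finset.univ.filter fun j : Fin N => j.val < k) ⊆ G.nbrs x := fun t ht => by
    rw [Finset.mem_filter] at ht
    rw [mem_nbrs]
    exact (hfull t x ht.2 fun he => by subst he; omega).symm
  have heq := Finset.eq_of_subset_of_card_le hsub (by
    rw [card_nbrs, h, if_neg (by omega), card_filter_val_lt hk])
  rw [← mem_nbrs, ← heq, Finset.mem_filter]
  omega

theorem exists_adj_notMem_of_card_le_three :
    ∀ s : Finset (Fin 6), s.card ≤ 3 → ∃ a b, a ∉ s ∧ b ∉ s ∧ K6C5.Adj a b := by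
  decide +kernel

theorem not_containsK6C5_of_degCount_eq (hN : 3 ≤ N)
    (h : ∀ i, degCount G i = if i.val < 3 then N - 1 else 3) : ¬ ContainsK6C5 G := by
  rintro ⟨f, hf, hfG⟩
  obtain ⟨a, b, ha, hb, hab⟩ := exists_adj_notMem_of_card_le_three
    (Finset.univ.filter fun a => (f a).val < 3) (by
      rw [← Finset.card_image_of_injective _ hf]
      refine (Finset.card_le_card fun t ht => ?_).trans (card_filter_val_lt hN).le
      obtain ⟨a, ha, rfl⟩ := Finset.mem_image.1 ht
      simpa using ha)
  simp only [Finset.mem_filter, Finset.mem_univ, true_and, not_lt] at ha hb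
  exact not_adj_of_degCount_eq hN h ha hb (hfG a b hab)

theorem _root_.PotentiallyK6C5.of_le_sum {l : List ℕ} (hl : 6 ≤ l.length) (hG : IsGraphic l)
    (hsum : 6 * l.length ≤ l.sum + 10) : PotentiallyK6C5 l := by
  obtain ⟨G, hG⟩ := hG
  have h : ∑ i, degCount G i = l.sum := by
    rw [Finset.sum_congr rfl fun i _ => hG i, ← List.sum_ofFn, List.ofFn_get]
  obtain ⟨H, hH, hK⟩ := sumForcesK6C5 hl Finset.univ (by simp) G (by simp) (by omega)
  exact ⟨H, fun i => (hH i).trans (hG i), hK⟩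

end SimpleGraph

theorem sigma_K6C5_least (n : ℕ) (hn : 6 ≤ n) :
    (IsGraphic (List.replicate 3 (n - 1) ++ List.replicate (n - 3) 3) ∧
     (List.replicate 3 (n - 1) ++ List.replicate (n - 3) 3).sum = 6 * n - 12 ∧
     ¬ PotentiallyK6C5 (List.replicate 3 (n - 1) ++ List.replicate (n - 3) 3)) ∧
    IsLeast {m : ℕ | Even m ∧ ∀ l : List ℕ, l.length = n → (∀ x ∈ l, 0 < x) →
        IsGraphic l → m ≤ l.sum → PotentiallyK6C5 l} (6 * n - 10) := by
  set l := List.replicate 3 (n - 1) ++ List.replicate (n - 3) 3 with hl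
  have hlen : l.length = n := by
    simp only [hl, List.length_append, List.length_replicate]
    omega
  have hget : ∀ i : Fin l.length, l.get i = if i.val < 3 then l.length - 1 else 3 := fun i => by
    rw [List.get_eq_getElem]
    simp only [hlen]
    simp only [hl, List.getElem_append, List.length_replicate, List.getElem_replicate]
    rfl
  have hgraphic : IsGraphic l := ⟨SimpleGraph.dominated l.length 3, fun i => by
    rw [hget, SimpleGraph.degCount_dominated (by omega)]⟩
  have hsum : l.sum = 6 * n - 12 := by
    simp only [hl, List.sum_append, List.sum_replicate, smul_eq_mul]
    omega
  have hnot : ¬ PotentiallyK6C5 l := fun ⟨G, hG, hK⟩ =>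
    SimpleGraph.not_containsK6C5_of_degCount_eq (by omega)
      (fun i => (hG i).trans (hget i)) hK
  refine ⟨⟨hgraphic, hsum, hnot⟩, ⟨⟨3 * n - 5, by omega⟩, fun l' hl' _ hG hm => ?_⟩, ?_⟩
  · exact .of_le_sum (by omega) hG (by omega)
  · rintro m ⟨⟨k, hk⟩, hm⟩
    by_contra hlt
    refine hnot (hm l hlen (fun x hx => ?_) hgraphic (by omega))
    simp only [hl, List.mem_append, List.mem_replicate] at hx
    omega
end
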